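/- arXiv:2304.02164 — 2 statements merged into one kernel-verified Lean document; each statement's English description precedes it below -/
import Mathlib

section
/- For every ε > 0 there exists n₀ such that for all integers n ≥ n₀, H_n(C_6) ≤ n^{(2/3 + ε)n}; that is, the maximum size of a family of Hamilton paths in K_n the union of any two of which contains a 6-cycle is at most n^{(2/3)n + o(n)}. -/
open SimpleGraph

/-- `H` is contained in `G` as a subgraph:
there is an injective map preserving adjacency. -/
def ContainsCopy {W V : Type*} (H : SimpleGraph W) (G : SimpleGraph V) : Prop :=
  ∃ f : W ↪ V, ∀ ⦃a b : W⦄, H.Adj a b → G.Adj (f a) (f b)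

/-- The union of (the edge sets of) two walks in the complete graph on `Fin n`,
as a simple graph on `Fin n`. -/
def walkUnion {n : ℕ} {u v u' v' : Fin n}
    (p : (⊤ : SimpleGraph (Fin n)).Walk u v) (q : (⊤ : SimpleGraph (Fin n)).Walk u' v') :
    SimpleGraph (Fin n) :=
  (p.toSubgraph ⊔ q.toSubgraph).spanningCoe

section Geometry

variable {F : Type} [Field F] [Fintype F] [DecidableEq F]

/-- The point `x • (1, t, t²)` of the cone over the moment curve. -/
def conePoint (c : F × F) : F × F × F := (c.2, c.1 * c.2, c.1 ^ 2 * c.2)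

/-- The point with first coordinate `x` on the line `(t, α, β)`, which is the line through
`(0, α, β)` in direction `(1, t, t²)`. -/
def linePoint (a : F × F × F) (x : F) : F × F × F :=
  (x, a.2.1 + a.1 * x, a.2.2 + a.1 ^ 2 * x)

omit [Fintype F] [DecidableEq F] in
/-- Three distinct points of the moment curve are linearly independent. -/
theorem moment_curve_independent {t r s x y z : F} (htr : t ≠ r) (hts : t ≠ s)
    (h1 : x + y + z = 0) (h2 : t * x + r * y + s * z = 0)
    (h3 : t ^ 2 * x + r ^ 2 * y + s ^ 2 * z = 0) : x = 0 := by
  have h : x * ((t - r) * (t - s)) = 0 := by linear_combination h3 - (r + s) * h2 + r * s * h1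
  exact (mul_eq_zero.1 h).resolve_right (mul_ne_zero (sub_ne_zero.2 htr) (sub_ne_zero.2 hts))

/-- The number of ways to write `w` as a difference of two points of the cone is at most
`q + 3 q r`, where `r` is the number of ways to write `w` as a point of the cone. -/
theorem card_conePoint_sub_le (w : F × F × F) :
    (Finset.univ.filter fun c : (F × F) × F × F => conePoint c.2 - conePoint c.1 = w).card ≤
      Fintype.card F + 3 * Fintype.card F *
        (Finset.univ.filter fun c : F × F => conePoint c = w).card := by
  set R := Finset.univ.filter fun c : F × F => conePoint c = w with hR
  set Z := Finset.univ.filter fun c : (F × F) × F × F => conePoint c.2 - conePoint c.1 = w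
    with hZ
  have hsub : Z ⊆ (Z.filter fun c => c.1.2 ≠ 0 ∧ c.2.2 ≠ 0 ∧ c.1.1 ≠ c.2.1) ∪
      (((Finset.univ ×ˢ R).image fun d : F × F × F => ((d.2.1, -d.2.2), (d.1, 0))) ∪
      (((Finset.univ ×ˢ R).image fun d : F × F × F => ((d.1, 0), (d.2.1, d.2.2))) ∪
      ((Finset.univ ×ˢ R).image fun d : F × F × F => ((d.2.1, d.1), (d.2.1, d.2.2 + d.1))))) := by
    rintro ⟨⟨t, x⟩, r, y⟩ hc
    have hw : conePoint (r, y) - conePoint (t, x) = w := by simpa [hZ] using hc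
    simp only [Finset.mem_union, Finset.mem_image, Finset.mem_product, Finset.mem_univ, true_and,
      Finset.mem_filter, hc, hR, Prod.exists, Prod.mk.injEq]
    by_cases hy : y = 0
    · right; left
      refine ⟨r, t, -x, ?_, by simp [hy]⟩
      rw [← hw, hy]; simp [conePoint]
    by_cases hx : x = 0
    · right; right; left
      refine ⟨t, r, y, ?_, by simp [hx]⟩
      rw [← hw, hx]; simp [conePoint]
    by_cases htr : t = r
    · right; right; right
      refine ⟨x, r, y - x, ?_, by simp [htr]⟩
      rw [← hw, htr]; simp [conePoint, mul_sub]
    · exact Or.inl ⟨hx, hy, htr⟩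
  have hgen : (Z.filter fun c => c.1.2 ≠ 0 ∧ c.2.2 ≠ 0 ∧ c.1.1 ≠ c.2.1).card ≤
      Fintype.card F := by
    refine Finset.card_le_card_of_injOn (fun c => c.1.1) (fun _ _ => Finset.mem_coe.2 (Finset.mem_univ _)) ?_
    rintro ⟨⟨t, x⟩, r, y⟩ hc ⟨⟨t', x'⟩, r', y'⟩ hc' htt
    simp only [hZ, Finset.coe_filter, Finset.mem_filter, Finset.mem_univ, true_and,
      Set.mem_ofPred_eq] at hc hc' htt
    obtain ⟨hw, hx, hy, htr⟩ := hc
    obtain ⟨hw', hx', hy', htr'⟩ := hc'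
    subst htt
    rw [← hw'] at hw
    simp only [conePoint, Prod.mk_sub_mk, Prod.mk.injEq] at hw
    obtain ⟨h1, h2, h3⟩ := hw
    by_cases hrr : r = r'
    · subst hrr
      have hyy : (r - t) * (y - y') = 0 := by linear_combination h2 - t * h1
      have hyy' := sub_eq_zero.1 ((mul_eq_zero.1 hyy).resolve_left (sub_ne_zero.2 (Ne.symm htr)))
      subst hyy'
      have : x = x' := by linear_combination -h1
      subst this
      rfl
    · refine absurd (moment_curve_independent (x := y) (y := -y') (z := x' - x) hrr (Ne.symm htr)
        ?_ ?_ ?_) hy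
      · linear_combination h1
      · linear_combination h2
      · linear_combination h3
  have hprod : ((Finset.univ : Finset F) ×ˢ R).card = Fintype.card F * R.card := by
    rw [Finset.card_product, Finset.card_univ]
  calc Z.card ≤ _ := Finset.card_le_card hsub
    _ ≤ _ := Finset.card_union_le _ _
    _ ≤ Fintype.card F + (Fintype.card F * R.card + (Fintype.card F * R.card +
          Fintype.card F * R.card)) := by
        refine add_le_add hgen ((Finset.card_union_le _ _).trans (add_le_add ?_
          ((Finset.card_union_le _ _).trans (add_le_add ?_ ?_)))) <;>
        exact Finset.card_image_le.trans hprod.le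
    _ = _ := by ring

/-- Sums of a function over its translates along the cone. -/
def coneSum (f : F × F × F → ℝ) (u : F × F × F) : ℝ := ∑ c : F × F, f (u + conePoint c)

/-- Sums of a function over the points of a line. -/
def lineSum (f : F × F × F → ℝ) (a : F × F × F) : ℝ := ∑ x : F, f (linePoint a x)

omit [DecidableEq F] in
theorem sum_coneSum (f : F × F × F → ℝ) :
    ∑ u, coneSum f u = (Fintype.card F : ℝ) ^ 2 * ∑ u, f u := by
  unfold coneSum
  rw [Finset.sum_comm]
  have : ∀ c : F × F, ∑ u, f (u + conePoint c) = ∑ u, f u := fun c =>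
    Equiv.sum_comp (Equiv.addRight (conePoint c)) f
  simp [this, sq]

/-- The incidences of a direction are parametrized by the points. -/
def lineIncidenceEquiv : (F × F × F) × F ≃ (F × F × F) × F where
  toFun c := (linePoint c.1 c.2, c.1.1)
  invFun c := ((c.2, c.1.2.1 - c.2 * c.1.1, c.1.2.2 - c.2 ^ 2 * c.1.1), c.1.1)
  left_inv := by rintro ⟨⟨t, α, β⟩, x⟩; simp [linePoint]
  right_inv := by rintro ⟨⟨x, y, z⟩, t⟩; simp [linePoint]

omit [DecidableEq F] in
theorem sum_lineSum (f : F × F × F → ℝ) :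
    ∑ a, lineSum f a = Fintype.card F * ∑ u, f u := by
  unfold lineSum
  rw [← Fintype.sum_prod_type' (f := fun a x => f (linePoint a x)),
    show ∑ x : (F × F × F) × F, f (linePoint x.1 x.2) = ∑ x, f (lineIncidenceEquiv x).1 from rfl,
    lineIncidenceEquiv.sum_comp (fun c : (F × F × F) × F => f c.1), Fintype.sum_prod_type]
  simp [Finset.mul_sum]

omit [DecidableEq F] in
theorem sum_lineSum_sq (f : F × F × F → ℝ) :
    ∑ a, lineSum f a ^ 2 = ∑ u, f u * coneSum f u := by
  have h1 : ∀ a : F × F × F, lineSum f a ^ 2 =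
      ∑ x, f (linePoint a x) * ∑ y, f (linePoint a x + conePoint (a.1, y)) := by
    intro a
    rw [sq, lineSum, Finset.sum_mul]
    refine Finset.sum_congr rfl fun x _ => ?_
    congr 1
    rw [← Equiv.sum_comp (Equiv.addLeft x)]
    refine Finset.sum_congr rfl fun y _ => ?_
    congr 1
    simp only [linePoint, conePoint, Equiv.coe_addLeft, Prod.mk_add_mk, Prod.mk.injEq, true_and]
    constructor <;> ring
  simp only [h1]
  rw [← Fintype.sum_prod_type' (f := fun (a : F × F × F) x =>
      f (linePoint a x) * ∑ y, f (linePoint a x + conePoint (a.1, y))),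
    show ∑ x : (F × F × F) × F, f (linePoint x.1 x.2) *
        ∑ y, f (linePoint x.1 x.2 + conePoint (x.1.1, y)) =
      ∑ x, (fun c : (F × F × F) × F => f c.1 * ∑ y, f (c.1 + conePoint (c.2, y)))
        (lineIncidenceEquiv x) from rfl,
    lineIncidenceEquiv.sum_comp
      (fun c : (F × F × F) × F => f c.1 * ∑ y, f (c.1 + conePoint (c.2, y))),
    Fintype.sum_prod_type]
  refine Finset.sum_congr rfl fun u _ => ?_
  rw [coneSum, Fintype.sum_prod_type, Finset.mul_sum]

theorem sum_coneSum_sq_le (f : F × F × F → ℝ) (h0 : ∀ u, 0 ≤ f u) (h1 : ∀ u, f u ≤ 1) :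
    ∑ u, coneSum f u ^ 2 ≤
      Fintype.card F * (∑ u, f u) ^ 2 + 3 * (Fintype.card F : ℝ) ^ 3 * ∑ u, f u := by
  have hsq : ∑ u, coneSum f u ^ 2 =
      ∑ c : (F × F) × F × F, ∑ u, f u * f (u + (conePoint c.2 - conePoint c.1)) := by
    have : ∀ u, coneSum f u ^ 2 = ∑ c : (F × F) × F × F,
        f (u + conePoint c.1) * f (u + conePoint c.2) := by
      intro u
      rw [sq, coneSum, Finset.sum_mul_sum, ← Fintype.sum_prod_type']
    simp only [this]
    rw [Finset.sum_comm]
    refine Finset.sum_congr rfl fun c _ => ?_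
    rw [← Equiv.sum_comp (Equiv.addRight (conePoint c.1))
      (fun u => f u * f (u + (conePoint c.2 - conePoint c.1)))]
    refine Finset.sum_congr rfl fun u _ => ?_
    simp only [Equiv.coe_addRight]
    congr 2
    abel
  have hfib : ∀ {ι : Type} [Fintype ι] (g : ι → F × F × F) (k : F × F × F → ℝ),
      ∑ c, k (g c) = ∑ w, ((Finset.univ.filter fun c => g c = w).card : ℝ) * k w := by
    intro ι _ g k
    rw [← Finset.sum_fiberwise (s := Finset.univ) (g := g)]
    refine Finset.sum_congr rfl fun w _ => ?_
    rw [Finset.sum_congr rfl (g := fun _ => k w)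
      (fun c hc => by rw [(Finset.mem_filter.1 hc).2]), Finset.sum_const, nsmul_eq_mul]
  rw [hsq, hfib (fun c : (F × F) × F × F => conePoint c.2 - conePoint c.1)
    (fun w => ∑ u, f u * f (u + w))]
  have hk : ∀ w, 0 ≤ ∑ u, f u * f (u + w) := fun w =>
    Finset.sum_nonneg fun u _ => mul_nonneg (h0 _) (h0 _)
  have hall : ∑ w, ∑ u, f u * f (u + w) = (∑ u, f u) ^ 2 := by
    rw [Finset.sum_comm, sq, Finset.sum_mul]
    refine Finset.sum_congr rfl fun u _ => ?_
    rw [← Finset.mul_sum, ← Equiv.sum_comp (Equiv.addLeft u) f]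
    rfl
  have hcone : ∑ w, ((Finset.univ.filter fun c : F × F => conePoint c = w).card : ℝ) *
      ∑ u, f u * f (u + w) ≤ (Fintype.card F : ℝ) ^ 2 * ∑ u, f u := by
    rw [← hfib (fun c : F × F => conePoint c) (fun w => ∑ u, f u * f (u + w))]
    calc ∑ c : F × F, ∑ u, f u * f (u + conePoint c) ≤ ∑ _c : F × F, ∑ u, f u :=
          Finset.sum_le_sum fun c _ => Finset.sum_le_sum fun u _ =>
            mul_le_of_le_one_right (h0 _) (h1 _)
      _ = _ := by simp [sq]
  calc _ ≤ ∑ w, ((Fintype.card F : ℝ) + 3 * Fintype.card F *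
        (Finset.univ.filter fun c : F × F => conePoint c = w).card) * ∑ u, f u * f (u + w) := by
        refine Finset.sum_le_sum fun w _ => mul_le_mul_of_nonneg_right ?_ (hk w)
        exact_mod_cast card_conePoint_sub_le w
    _ = (Fintype.card F : ℝ) * ∑ w, ∑ u, f u * f (u + w) + 3 * Fintype.card F *
        ∑ w, ((Finset.univ.filter fun c : F × F => conePoint c = w).card : ℝ) *
          ∑ u, f u * f (u + w) := by
        rw [Finset.mul_sum, Finset.mul_sum, ← Finset.sum_add_distrib]
        exact Finset.sum_congr rfl fun w _ => by ring
    _ ≤ (Fintype.card F : ℝ) * (∑ u, f u) ^ 2 + 3 * Fintype.card F *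
        ((Fintype.card F : ℝ) ^ 2 * ∑ u, f u) := by
        rw [hall]
        gcongr
    _ = _ := by ring

/-- A set of points and a set of lines with at most half of the expected number of incidences
cannot both be large. -/
theorem sq_mul_le_of_few_incidences (U X : Finset (F × F × F))
    (h : 2 * (Fintype.card F : ℝ) ^ 2 * ∑ a ∈ X, lineSum (fun u => if u ∈ U then 1 else 0) a ≤
      X.card * U.card) :
    ((X.card : ℝ) * U.card) ^ 2 ≤ 48 * (Fintype.card F : ℝ) ^ 11 := by
  set f : F × F × F → ℝ := fun u => if u ∈ U then 1 else 0 with hf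
  set q : ℝ := (Fintype.card F : ℝ) with hq
  have hq0 : 0 < q := by rw [hq]; exact_mod_cast Fintype.card_pos
  have hcard : (Fintype.card (F × F × F) : ℝ) = q ^ 3 := by
    simp only [Fintype.card_prod, Nat.cast_mul, ← hq]; ring
  have h0 : ∀ u, 0 ≤ f u := fun u => by simp only [hf]; split_ifs <;> norm_num
  have h1 : ∀ u, f u ≤ 1 := fun u => by simp only [hf]; split_ifs <;> norm_num
  have hff : ∀ u, f u ^ 2 = f u := fun u => by simp only [hf]; split_ifs <;> norm_num
  have hsum : ∑ u, f u = U.card := by simp [hf]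
  set u : ℝ := (U.card : ℝ) with hu
  set x : ℝ := (X.card : ℝ) with hx
  have hu0 : 0 ≤ u := by positivity
  have hx0 : 0 ≤ x := by positivity
  have hvar : ∑ v, (coneSum f v - u / q) ^ 2 ≤ 3 * q ^ 3 * u := by
    have e : ∑ v, (coneSum f v - u / q) ^ 2 =
        ∑ v, coneSum f v ^ 2 - 2 * (u / q) * ∑ v, coneSum f v + q ^ 3 * (u / q) ^ 2 := by
      rw [← hcard, Finset.mul_sum, ← Finset.sum_sub_distrib, ← nsmul_eq_mul, ← Finset.card_univ,
        ← Finset.sum_const, ← Finset.sum_add_distrib]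
      exact Finset.sum_congr rfl fun v _ => by ring
    rw [e, sum_coneSum, hsum]
    have := sum_coneSum_sq_le f h0 h1
    rw [hsum] at this
    have e2 : 2 * (u / q) * (q ^ 2 * u) = 2 * (q * u ^ 2) := by field_simp
    have e3 : q ^ 3 * (u / q) ^ 2 = q * u ^ 2 := by field_simp
    rw [e2, e3]
    linarith
  set E : ℝ := ∑ a, (lineSum f a - u / q ^ 2) ^ 2 with hE
  have hE0 : 0 ≤ E := Finset.sum_nonneg fun a _ => sq_nonneg _
  have hEeq : E = ∑ v, f v * (coneSum f v - u / q) := by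
    have e : E = ∑ a, lineSum f a ^ 2 - 2 * (u / q ^ 2) * ∑ a, lineSum f a +
        q ^ 3 * (u / q ^ 2) ^ 2 := by
      rw [hE, ← hcard, Finset.mul_sum, ← Finset.sum_sub_distrib, ← nsmul_eq_mul,
        ← Finset.card_univ, ← Finset.sum_const, ← Finset.sum_add_distrib]
      exact Finset.sum_congr rfl fun v _ => by ring
    rw [e, sum_lineSum_sq, sum_lineSum]
    simp only [mul_sub, Finset.sum_sub_distrib, ← Finset.sum_mul, hsum]
    field_simp
    ring
  have hE2 : E ^ 2 ≤ u * (3 * q ^ 3 * u) := by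
    rw [hEeq]
    refine (Finset.sum_mul_sq_le_sq_mul_sq _ _ _).trans ?_
    simp only [hff, hsum]
    gcongr
  have hX : (x * u / (2 * q ^ 2)) ^ 2 ≤ x * E := by
    have hlow : x * u / (2 * q ^ 2) ≤ ∑ a ∈ X, 1 * (u / q ^ 2 - lineSum f a) := by
      simp only [one_mul, Finset.sum_sub_distrib, Finset.sum_const, nsmul_eq_mul]
      have : ∑ a ∈ X, lineSum f a ≤ x * u / (2 * q ^ 2) := by
        rw [le_div_iff₀ (by positivity)]; linarith
      have e : (x : ℝ) * (u / q ^ 2) = 2 * (x * u / (2 * q ^ 2)) := by field_simp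
      linarith
    calc _ ≤ (∑ a ∈ X, 1 * (u / q ^ 2 - lineSum f a)) ^ 2 := by gcongr
      _ ≤ (∑ a ∈ X, (1 : ℝ) ^ 2) * ∑ a ∈ X, (u / q ^ 2 - lineSum f a) ^ 2 :=
        Finset.sum_mul_sq_le_sq_mul_sq _ _ _
      _ ≤ x * E := by
        simp only [one_pow, Finset.sum_const, nsmul_eq_mul, mul_one]
        gcongr
        rw [hE]
        calc ∑ a ∈ X, (u / q ^ 2 - lineSum f a) ^ 2
            = ∑ a ∈ X, (lineSum f a - u / q ^ 2) ^ 2 :=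
              Finset.sum_congr rfl fun a _ => by ring
          _ ≤ _ := Finset.sum_le_sum_of_subset_of_nonneg (Finset.subset_univ _)
              fun a _ _ => sq_nonneg _
  rcases eq_or_lt_of_le (mul_nonneg hx0 hu0) with h' | h'
  · rw [← h', zero_pow two_ne_zero]; positivity
  have h4 : (x * u / (2 * q ^ 2)) ^ 4 ≤ (x * u) ^ 2 * (3 * q ^ 3) := by
    calc (x * u / (2 * q ^ 2)) ^ 4 = ((x * u / (2 * q ^ 2)) ^ 2) ^ 2 := by ring
      _ ≤ (x * E) ^ 2 := by gcongr
      _ = x ^ 2 * E ^ 2 := by ring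
      _ ≤ x ^ 2 * (u * (3 * q ^ 3 * u)) := by gcongr
      _ = _ := by ring
  rw [div_pow, div_le_iff₀ (by positivity)] at h4
  have h5 : (x * u) ^ 2 * (x * u) ^ 2 ≤ (x * u) ^ 2 * (48 * q ^ 11) := by
    calc _ = (x * u) ^ 4 := by ring
      _ ≤ _ := h4
      _ = _ := by ring
  exact le_of_mul_le_mul_left h5 (by positivity)

theorem lineSum_indicator (U : Finset (F × F × F)) (a : F × F × F) :
    lineSum (fun u => if u ∈ U then 1 else 0) a =
      ((U.filter fun u => linePoint a u.1 = u).card : ℝ) := by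
  rw [lineSum, Finset.sum_boole]
  congr 1
  refine Finset.card_bij (fun x _ => linePoint a x) (fun x hx => ?_) (fun x _ y _ h => ?_)
    (fun u hu => ?_)
  · exact Finset.mem_filter.2 ⟨(Finset.mem_filter.1 hx).2, rfl⟩
  · exact congrArg Prod.fst h
  · obtain ⟨hu, h⟩ := Finset.mem_filter.1 hu
    exact ⟨u.1, by simp [h, hu], h⟩

variable (F) in
/-- The incidence graph between the points of `F³` (on the left) and the lines of `F³` in the
directions of the moment curve (on the right). -/
def incidenceGraph : SimpleGraph ((F × F × F) ⊕ (F × F × F)) where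
  Adj
    | .inl u, .inr a => linePoint a u.1 = u
    | .inr a, .inl u => linePoint a u.1 = u
    | _, _ => False
  symm := ⟨by rintro (u | a) (v | b) h <;> exact h⟩
  loopless := ⟨by rintro (u | a) h <;> exact h⟩

omit [Fintype F] [DecidableEq F] in
theorem linePoint_sub (a : F × F × F) (x y : F) :
    linePoint a x - linePoint a y = conePoint (a.1, x - y) := by
  simp only [linePoint, conePoint, Prod.mk_sub_mk, Prod.mk.injEq, true_and]
  constructor <;> ring

omit [Fintype F] [DecidableEq F] in
theorem line_eq_of_direction_eq {a b : F × F × F} {x : F} (h : linePoint a x = linePoint b x)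
    (hd : a.1 = b.1) : a = b := by
  obtain ⟨t, α, β⟩ := a
  obtain ⟨s, γ, δ⟩ := b
  simp only at hd
  subst hd
  simpa [linePoint] using h

omit [Fintype F] [DecidableEq F] in
/-- There are no triangles of lines in the directions of the moment curve. -/
theorem no_triangle {u v w a b c : F × F × F} (huv : u ≠ v) (hab : a ≠ b)
    (hca : c ≠ a) (hua : linePoint a u.1 = u) (hva : linePoint a v.1 = v)
    (hvb : linePoint b v.1 = v) (hwb : linePoint b w.1 = w) (hwc : linePoint c w.1 = w)
    (huc : linePoint c u.1 = u) : False := by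
  have hab' : a.1 ≠ b.1 := fun h => hab (line_eq_of_direction_eq (hva.trans hvb.symm) h)
  have hca' : a.1 ≠ c.1 := fun h => hca (line_eq_of_direction_eq (huc.trans hua.symm) h.symm)
  have h1 := linePoint_sub a u.1 v.1
  have h2 := linePoint_sub b v.1 w.1
  have h3 := linePoint_sub c w.1 u.1
  rw [hua, hva] at h1
  rw [hvb, hwb] at h2
  rw [hwc, huc] at h3
  have h : conePoint (a.1, u.1 - v.1) + conePoint (b.1, v.1 - w.1) +
      conePoint (c.1, w.1 - u.1) = 0 := by
    rw [← h1, ← h2, ← h3]; abel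
  simp only [conePoint, Prod.mk_add_mk, Prod.mk_eq_zero] at h
  have h0 := sub_eq_zero.1 (moment_curve_independent hab' hca' h.1 h.2.1 h.2.2)
  exact huv (by rw [← hua, ← hva, h0])

omit [Fintype F] [DecidableEq F] in
theorem incidenceGraph_C6_free : ¬ ContainsCopy (cycleGraph 6) (incidenceGraph F) := by
  rintro ⟨f, hf⟩
  have h (i : Fin 6) : (incidenceGraph F).Adj (f i) (f (i + 1)) :=
    hf (by simp [cycleGraph_adj])
  have hne {i j : Fin 6} (hij : i ≠ j) : f i ≠ f j := f.injective.ne hij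
  have h0 := h 0
  have h1 := h 1
  have h2 := h 2
  have h3 := h 3
  have h4 := h 4
  have h5 := h 5
  have n02 := hne (show (0 : Fin 6) ≠ 2 by decide)
  have n24 := hne (show (2 : Fin 6) ≠ 4 by decide)
  have n13 := hne (show (1 : Fin 6) ≠ 3 by decide)
  have n51 := hne (show (5 : Fin 6) ≠ 1 by decide)
  simp only [Fin.reduceAdd, zero_add] at h0 h1 h2 h3 h4 h5
  generalize f 0 = v0 at *
  generalize f 1 = v1 at *
  generalize f 2 = v2 at *
  generalize f 3 = v3 at *
  generalize f 4 = v4 at *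
  generalize f 5 = v5 at *
  rcases v0 with v0 | v0 <;> rcases v1 with v1 | v1 <;> try exact h0
  · rcases v2 with v2 | v2 <;> try exact h1
    rcases v3 with v3 | v3 <;> try exact h2
    rcases v4 with v4 | v4 <;> try exact h3
    rcases v5 with v5 | v5 <;> try exact h4
    exact no_triangle (fun h => n02 (by rw [h])) (fun h => n13 (by rw [h]))
      (fun h => n51 (by rw [h])) h0 h1 h2 h3 h4 h5
  · rcases v2 with v2 | v2 <;> try exact h1
    rcases v3 with v3 | v3 <;> try exact h2
    rcases v4 with v4 | v4 <;> try exact h3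
    rcases v5 with v5 | v5 <;> try exact h4
    exact no_triangle (fun h => n13 (by rw [h])) (fun h => n24 (by rw [h]))
      (fun h => n02 (by rw [h])) h1 h2 h3 h4 h5 h0

/-- If `U` contains at least a `1/k` fraction of the points and `X` is a set of lines with few
incidences with `U`, then `X` contains at most a `1/k` fraction of the lines (and vice versa). -/
theorem card_mul_le_of_few_incidences {k x u q : ℕ} (hk : 48 * k ^ 4 ≤ q)
    (hu : q ^ 3 ≤ k * u) (h : ((x : ℝ) * u) ^ 2 ≤ 48 * (q : ℝ) ^ 11) : x * k ≤ q ^ 3 := by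
  have h' : (x * u) ^ 2 ≤ 48 * q ^ 11 := by exact_mod_cast h
  rcases Nat.eq_zero_or_pos q with rfl | hq
  · have : k = 0 := by
      by_contra hk0
      have := pow_pos (Nat.pos_of_ne_zero hk0) 4
      omega
    simp [this]
  by_contra! hx
  have h1 : q ^ 12 < 48 * q ^ 11 * k ^ 4 := by
    calc q ^ 12 = (q ^ 3 * q ^ 3) ^ 2 := by ring
      _ < (x * k * (k * u)) ^ 2 := by
        refine Nat.pow_lt_pow_left ?_ two_ne_zero
        exact Nat.mul_lt_mul_of_lt_of_le hx hu ((pow_pos hq 3).trans_le hu)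
      _ = (x * u) ^ 2 * k ^ 4 := by ring
      _ ≤ _ := Nat.mul_le_mul_right _ h'
  have h2 : 48 * q ^ 11 * k ^ 4 ≤ q ^ 12 := by
    calc 48 * q ^ 11 * k ^ 4 = q ^ 11 * (48 * k ^ 4) := by ring
      _ ≤ q ^ 11 * q := by gcongr
      _ = _ := by ring
  omega

open Classical in
/-- In the incidence graph, few vertices have few neighbours in a set which is large on both
sides. -/
theorem incidenceGraph_few_bad {k h D : ℕ} (hk : 48 * k ^ 4 ≤ Fintype.card F)
    (hh : Fintype.card F ^ 3 ≤ k * h) (hD : 2 * Fintype.card F ^ 2 * D ≤ h)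
    (S : Finset ((F × F × F) ⊕ (F × F × F)))
    (hS : ∀ b, h ≤ (S.filter fun v => v.isLeft = b).card) :
    (Finset.univ.filter fun v =>
      (S.filter fun w => (incidenceGraph F).Adj v w).card < D).card * k ≤
      2 * Fintype.card F ^ 3 := by
  set q := Fintype.card F with hq
  set B := Finset.univ.filter fun v =>
      (S.filter fun w => (incidenceGraph F).Adj v w).card < D with hB
  have hSl : h ≤ S.toLeft.card := by
    refine (hS true).trans ?_
    rw [← Finset.card_map Function.Embedding.inl (s := S.toLeft)]
    refine Finset.card_le_card ?_
    rintro (u | a) hu <;> simp_all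
  have hSr : h ≤ S.toRight.card := by
    refine (hS false).trans ?_
    rw [← Finset.card_map Function.Embedding.inr (s := S.toRight)]
    refine Finset.card_le_card ?_
    rintro (u | a) hu <;> simp_all
  have hcomm : ∀ U X : Finset (F × F × F),
      ∑ a ∈ X, (U.filter fun u => linePoint a u.1 = u).card =
      ∑ u ∈ U, (X.filter fun a => linePoint a u.1 = u).card := fun U X =>
    Finset.sum_card_bipartiteAbove_eq_sum_card_bipartiteBelow (fun a u => linePoint a u.1 = u)
  have key : ∀ U X : Finset (F × F × F),
      2 * q ^ 2 * ∑ a ∈ X, (U.filter fun u => linePoint a u.1 = u).card ≤ X.card * U.card →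
      ((X.card : ℝ) * U.card) ^ 2 ≤ 48 * (q : ℝ) ^ 11 := by
    intro U X hUX
    refine sq_mul_le_of_few_incidences U X ?_
    simp only [lineSum_indicator]
    exact_mod_cast hUX
  have hr : B.toRight.card * k ≤ q ^ 3 := by
    refine card_mul_le_of_few_incidences hk (hh.trans (Nat.mul_le_mul_left k hSl))
      (key S.toLeft B.toRight ?_)
    have : ∑ a ∈ B.toRight, (S.toLeft.filter fun u => linePoint a u.1 = u).card ≤
        ∑ _a ∈ B.toRight, D := by
      refine Finset.sum_le_sum fun a ha => ?_
      rw [Finset.mem_toRight, hB, Finset.mem_filter] at ha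
      refine le_trans ?_ ha.2.le
      rw [← Finset.card_map Function.Embedding.inl]
      refine Finset.card_le_card ?_
      intro v hv
      obtain ⟨u, hu, rfl⟩ := Finset.mem_map.1 hv
      obtain ⟨hu, h⟩ := Finset.mem_filter.1 hu
      exact Finset.mem_filter.2 ⟨Finset.mem_toLeft.1 hu, h⟩
    rw [Finset.sum_const, smul_eq_mul] at this
    calc _ ≤ 2 * q ^ 2 * (B.toRight.card * D) := by gcongr
      _ = B.toRight.card * (2 * q ^ 2 * D) := by ring
      _ ≤ _ := by gcongr; exact hD.trans hSl
  have hl : B.toLeft.card * k ≤ q ^ 3 := by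
    refine card_mul_le_of_few_incidences hk (hh.trans (Nat.mul_le_mul_left k hSr)) ?_
    rw [mul_comm (B.toLeft.card : ℝ)]
    refine key B.toLeft S.toRight ?_
    rw [hcomm]
    have : ∑ u ∈ B.toLeft, (S.toRight.filter fun a => linePoint a u.1 = u).card ≤
        ∑ _u ∈ B.toLeft, D := by
      refine Finset.sum_le_sum fun a ha => ?_
      rw [Finset.mem_toLeft, hB, Finset.mem_filter] at ha
      refine le_trans ?_ ha.2.le
      rw [← Finset.card_map Function.Embedding.inr]
      refine Finset.card_le_card ?_
      intro v hv
      obtain ⟨u, hu, rfl⟩ := Finset.mem_map.1 hv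
      obtain ⟨hu, h⟩ := Finset.mem_filter.1 hu
      exact Finset.mem_filter.2 ⟨Finset.mem_toRight.1 hu, h⟩
    rw [Finset.sum_const, smul_eq_mul] at this
    calc _ ≤ 2 * q ^ 2 * (B.toLeft.card * D) := by gcongr
      _ = (2 * q ^ 2 * D) * B.toLeft.card := by ring
      _ ≤ _ := by gcongr; exact hD.trans hSr
  rw [← Finset.card_toLeft_add_card_toRight, add_mul]
  omega

end Geometry

section Greedy

/-- The indices `i` at which a sequence of vertices does not continue along an edge of `G`
(including the last index). -/
noncomputable def breaks {V : Type} (G : SimpleGraph V) {m : ℕ} (a : Fin m ≃ V) : Finset (Fin m) :=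
  open Classical in
  Finset.univ.filter fun i => ∀ h : i.val + 1 < m, ¬ G.Adj (a i) (a ⟨i.val + 1, h⟩)

theorem mem_breaks {V : Type} {G : SimpleGraph V} {m : ℕ} {a : Fin m ≃ V} {i : Fin m} :
    i ∈ breaks G a ↔ ∀ h : i.val + 1 < m, ¬ G.Adj (a i) (a ⟨i.val + 1, h⟩) := by
  simp [breaks]

variable {V : Type} [Fintype V]

open Classical in
/-- The neighbours of the head of `l` which do not occur in `l`. -/
noncomputable def freshNeighbors (G : SimpleGraph V) : List V → Finset V
  | [] => ∅
  | v :: l => Finset.univ.filter fun w => G.Adj v w ∧ w ∉ v :: l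

open Classical in
/-- The vertices by which the greedy procedure may extend `l`: the fresh neighbours of its head if
there are at least `D` of them, and otherwise all fresh vertices of the colour determined by the
parity of the length of `l`. -/
noncomputable def extensions (G : SimpleGraph V) (color : V → Bool) (D : ℕ) (l : List V) :
    Finset V :=
  if (freshNeighbors G l).card < D then
    Finset.univ.filter fun w => w ∉ l ∧ color w = l.length.bodd
  else freshNeighbors G l

open Classical in
/-- The sequences of length `t` produced by the greedy procedure, latest vertex first. -/
noncomputable def greedySeqs (G : SimpleGraph V) (color : V → Bool) (D : ℕ) : ℕ → Finset (List V)
  | 0 => {[]}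
  | t + 1 => (greedySeqs G color D t).biUnion fun l =>
      (extensions G color D l).image fun v => v :: l

open Classical in
/-- The number of steps of the greedy procedure in which there were few fresh neighbours. -/
noncomputable def stuckCount (G : SimpleGraph V) (D : ℕ) : List V → ℕ
  | [] => 0
  | _ :: l => stuckCount G D l + if (freshNeighbors G l).card < D then 1 else 0

/-- The colours along a sequence alternate, starting with `false` at the end of the list. -/
def Alternates (color : V → Bool) : List V → Prop
  | [] => True
  | v :: l => color v = l.length.bodd ∧ Alternates color l

omit [Fintype V] in
theorem Alternates.count {color : V → Bool} : ∀ {l : List V}, Alternates color l → ∀ b,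
    l.countP (fun v => color v = b) = (l.length + if b then 0 else 1) / 2
  | [], _, b => by cases b <;> simp
  | v :: l, h, b => by
    rw [List.countP_cons, Alternates.count h.2, h.1, List.length_cons]
    have := Nat.bodd_add_div2 l.length
    rw [Nat.div2_val] at this
    cases hb : l.length.bodd <;> cases b <;> simp_all <;> omega

open Classical in
theorem card_fresh_color {color : V → Bool} {N : ℕ}
    (hN : ∀ b, (Finset.univ.filter fun v => color v = b).card = N) {l : List V} (hl : l.Nodup)
    (ha : Alternates color l) (b : Bool) :
    (Finset.univ.filter fun w => w ∉ l ∧ color w = b).card + (l.length + if b then 0 else 1) / 2 =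
      N := by
  rw [← hN b, ← ha.count b, List.countP_eq_length_filter,
    ← List.toFinset_card_of_nodup (hl.filter _), ← Finset.card_union_of_disjoint]
  · congr 1
    ext w
    simp only [Finset.mem_union, Finset.mem_filter, Finset.mem_univ, true_and, List.mem_toFinset,
      List.mem_filter, decide_eq_true_eq]
    tauto
  · rw [Finset.disjoint_left]
    intro w hw hw'
    simp only [Finset.mem_filter, List.mem_toFinset, List.mem_filter] at hw hw'
    exact hw.2.1 hw'.1

variable {G : SimpleGraph V} {color : V → Bool} {D : ℕ}

theorem mem_greedySeqs_succ {t : ℕ} {l : List V} : l ∈ greedySeqs G color D (t + 1) ↔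
    ∃ v l', l = v :: l' ∧ l' ∈ greedySeqs G color D t ∧ v ∈ extensions G color D l' := by
  simp only [greedySeqs, Finset.mem_biUnion, Finset.mem_image]
  constructor
  · rintro ⟨l', hl', v, hv, rfl⟩
    exact ⟨v, l', rfl, hl', hv⟩
  · rintro ⟨v, l', rfl, hl', hv⟩
    exact ⟨l', hl', v, hv, rfl⟩

open Classical in
theorem notMem_of_mem_extensions {l : List V} {v : V} (h : v ∈ extensions G color D l) :
    v ∉ l := by
  unfold extensions at h
  split_ifs at h
  · exact (Finset.mem_filter.1 h).2.1
  · cases l with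
    | nil => simp
    | cons w l => exact (Finset.mem_filter.1 h).2.2

open Classical in
theorem greedySeqs_spec (hG : ∀ v w, G.Adj v w → color v ≠ color w) : ∀ {t : ℕ} {l : List V},
    l ∈ greedySeqs G color D t → l.length = t ∧ l.Nodup ∧ Alternates color l
  | 0, l, h => by
    rw [greedySeqs, Finset.mem_singleton] at h
    subst h
    exact ⟨rfl, List.nodup_nil, trivial⟩
  | t + 1, l, h => by
    obtain ⟨v, l, rfl, hl, hv⟩ := mem_greedySeqs_succ.1 h
    obtain ⟨h1, h2, h3⟩ := greedySeqs_spec hG hl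
    refine ⟨by simp [h1], List.nodup_cons.2 ⟨notMem_of_mem_extensions hv, h2⟩, ?_, h3⟩
    unfold extensions at hv
    split_ifs at hv
    · exact (Finset.mem_filter.1 hv).2.2
    · cases l with
      | nil => simp [freshNeighbors] at hv
      | cons w l =>
        have := hG _ _ (Finset.mem_filter.1 hv).2.1
        have hw := h3.1
        simp only [List.length_cons, Nat.bodd_succ]
        revert this hw
        cases color w <;> cases color v <;> simp +contextual

open Classical in
/-- The greedy procedure produces many sequences with few stuck steps. -/
theorem pow_le_sum_greedySeqs {N : ℕ}
    (hN : ∀ b, (Finset.univ.filter fun v => color v = b).card = N)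
    (hG : ∀ v w, G.Adj v w → color v ≠ color w) : ∀ {t : ℕ}, t ≤ 2 * N →
    D ^ t ≤ ∑ l ∈ greedySeqs G color D t, D ^ stuckCount G D l
  | 0, _ => by simp [greedySeqs, stuckCount]
  | t + 1, ht => by
    have ih := pow_le_sum_greedySeqs hN hG (t := t) (by omega)
    rw [greedySeqs, Finset.sum_biUnion, pow_succ]
    · refine (Nat.mul_le_mul_right D ih).trans ?_
      rw [Finset.sum_mul]
      refine Finset.sum_le_sum fun l hl => ?_
      rw [Finset.sum_image (fun v _ w _ h => (List.cons.inj h).1)]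
      simp only [stuckCount, Finset.sum_const, smul_eq_mul]
      by_cases hs : (freshNeighbors G l).card < D
      · rw [if_pos hs, pow_succ]
        refine Nat.le_mul_of_pos_left _ ?_
        rw [extensions, if_pos hs]
        obtain ⟨h1, h2, h3⟩ := greedySeqs_spec hG hl
        have := card_fresh_color hN h2 h3 l.length.bodd
        have h4 := Nat.bodd_add_div2 l.length
        rw [Nat.div2_val] at h4
        have h5 : (l.length + if l.length.bodd then 0 else 1) / 2 < N := by
          cases hb : l.length.bodd <;> simp_all <;> omega
        omega
      · rw [if_neg hs, add_zero, mul_comm, extensions, if_neg hs]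
        exact Nat.mul_le_mul_right _ (not_lt.1 hs)
    · intro l _ l' _ hll
      rw [Function.onFun, Finset.disjoint_left]
      intro k hk hk'
      obtain ⟨v, _, rfl⟩ := Finset.mem_image.1 hk
      obtain ⟨w, _, h⟩ := Finset.mem_image.1 hk'
      exact hll (List.cons.inj h).2.symm

theorem stuckCount_append_le (l₂ l₁ : List V) :
    stuckCount G D (l₂ ++ l₁) ≤ l₂.length + stuckCount G D l₁ := by
  induction l₂ with
  | nil => simp
  | cons v l ih =>
    rw [List.cons_append, stuckCount, List.length_cons]
    split_ifs <;> omega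

open Classical in
theorem stuckCount_le_of_fresh (S : Finset V) : ∀ l : List V, (∀ v ∈ l, v ∉ S) →
    stuckCount G D l ≤
      1 + l.tail.countP fun v => (S.filter fun w => G.Adj v w).card < D
  | [], _ => by simp [stuckCount]
  | [v], _ => by
    rw [stuckCount, stuckCount]
    split_ifs <;> simp
  | v :: w :: l, h => by
    have ih := stuckCount_le_of_fresh S (w :: l) fun x hx => h x (List.mem_cons_of_mem _ hx)
    rw [stuckCount, List.tail_cons, List.countP_cons]
    rw [List.tail_cons] at ih
    have : (freshNeighbors G (w :: l)).card < D →
        (S.filter fun x => G.Adj w x).card < D := by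
      refine fun hD => lt_of_le_of_lt (Finset.card_le_card fun x hx => ?_) hD
      obtain ⟨hxS, hx⟩ := Finset.mem_filter.1 hx
      exact Finset.mem_filter.2 ⟨Finset.mem_univ _, hx, fun hxl =>
        h x (List.mem_cons_of_mem _ hxl) hxS⟩
    split_ifs <;> simp_all <;> omega

open Classical in
/-- A full greedy sequence has few stuck steps, provided large sets of vertices have few
vertices with few neighbours in them. -/
theorem stuckCount_le {N h β : ℕ}
    (hN : ∀ b, (Finset.univ.filter fun v => color v = b).card = N)
    (hG : ∀ v w, G.Adj v w → color v ≠ color w)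
    (hbad : ∀ S : Finset V, (∀ b, h ≤ (S.filter fun v => color v = b).card) →
      (Finset.univ.filter fun v => (S.filter fun w => G.Adj v w).card < D).card ≤ β)
    (hh : h ≤ N) {l : List V} (hl : l ∈ greedySeqs G color D (2 * N)) :
    stuckCount G D l ≤ 2 * h + 1 + β := by
  obtain ⟨h1, h2, h3⟩ := greedySeqs_spec hG hl
  have halt : ∀ (l₂ l₁ : List V), Alternates color (l₂ ++ l₁) → Alternates color l₁ := by
    intro l₂ l₁ h
    induction l₂ with
    | nil => exact h
    | cons v l ih => exact ih h.2
  obtain ⟨l₂, l₁, rfl, hl₂⟩ : ∃ l₂ l₁, l = l₂ ++ l₁ ∧ l₂.length = 2 * h :=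
    ⟨l.take (2 * h), l.drop (2 * h), (List.take_append_drop _ _).symm, by
      rw [List.length_take]; omega⟩
  rw [List.length_append] at h1
  have hnd : l₁.Nodup := (List.nodup_append.1 h2).2.1
  obtain ⟨S, hS⟩ : ∃ S : Finset V, ∀ v, v ∈ S ↔ v ∉ l₁ :=
    ⟨Finset.univ.filter fun v => v ∉ l₁, by simp⟩
  have hbadS := hbad S fun b => by
    have h4 := card_fresh_color hN hnd (halt _ _ h3) b
    have h5 : (S.filter fun v => color v = b) =
        Finset.univ.filter fun w => w ∉ l₁ ∧ color w = b := by
      ext w; simp [hS]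
    rw [h5]
    cases b <;> simp_all <;> omega
  have hst := stuckCount_le_of_fresh (G := G) (D := D) S l₁ fun v hv hvS => (hS v).1 hvS hv
  have hcount : ∀ (p : V → Prop) [DecidablePred p], l₁.tail.countP (fun v => p v) ≤ (Finset.univ.filter p).card := by
    intro p _
    rw [List.countP_eq_length_filter,
      ← List.toFinset_card_of_nodup ((hnd.sublist (List.tail_sublist _)).filter _)]
    refine Finset.card_le_card fun v hv => ?_
    simpa using (List.mem_filter.1 (List.mem_toFinset.1 hv)).2
  have := stuckCount_append_le (G := G) (D := D) l₂ l₁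
  have := hcount fun v => (S.filter fun w => G.Adj v w).card < D
  omega

open Classical in
theorem adj_or_stuck_of_mem_greedySeqs {l : List V} {t : ℕ} {v w : V}
    (h : v :: w :: l ∈ greedySeqs G color D t) :
    (freshNeighbors G (w :: l)).card < D ∨ G.Adj v w := by
  cases t with
  | zero => simp [greedySeqs] at h
  | succ t =>
    obtain ⟨v', l', hvl, -, hv⟩ := mem_greedySeqs_succ.1 h
    obtain ⟨rfl, rfl⟩ := List.cons.inj hvl
    unfold extensions at hv
    split_ifs at hv with hs
    · exact Or.inl hs
    · exact Or.inr (Finset.mem_filter.1 hv).2.1.symm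

/-- The entries of `l` at `i` and `i + 1` exist and are adjacent. -/
def AdjAt (G : SimpleGraph V) (l : List V) (i : ℕ) : Prop :=
  ∃ v w, l[i]? = some v ∧ l[i + 1]? = some w ∧ G.Adj v w

open Classical in
theorem card_nonadj_le_stuckCount (hD : 0 < D) : ∀ {l : List V} {t : ℕ},
    l ∈ greedySeqs G color D t →
    ((Finset.range l.length).filter fun i => ¬ AdjAt G l i).card ≤ stuckCount G D l
  | [], _, _ => by simp
  | v :: l, 0, h => by simp [greedySeqs] at h
  | v :: l, t + 1, h => by
    have hl : l ∈ greedySeqs G color D t := by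
      obtain ⟨v', l', hvl, hl, -⟩ := mem_greedySeqs_succ.1 h
      rwa [(List.cons.inj hvl).2]
    have ih := card_nonadj_le_stuckCount hD hl
    set B := (Finset.range l.length).filter fun i => ¬ AdjAt G l i with hB
    have hsucc : ∀ i, i + 1 ∈ ((Finset.range (v :: l).length).filter
        fun i => ¬ AdjAt G (v :: l) i) → i + 1 ∈ B.map (addRightEmbedding 1) := by
      intro i hi
      rw [Finset.mem_filter, Finset.mem_range] at hi
      refine Finset.mem_map.2 ⟨i, Finset.mem_filter.2 ⟨?_, hi.2⟩, rfl⟩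
      simpa using hi.1
    rw [stuckCount]
    split_ifs with hs
    · calc _ ≤ (insert 0 (B.map (addRightEmbedding 1))).card := by
            refine Finset.card_le_card fun i hi => ?_
            cases i with
            | zero => exact Finset.mem_insert_self _ _
            | succ i => exact Finset.mem_insert_of_mem (hsucc i hi)
        _ ≤ B.card + 1 := (Finset.card_insert_le _ _).trans_eq (by rw [Finset.card_map])
        _ ≤ _ := by omega
    · calc _ ≤ (B.map (addRightEmbedding 1)).card := by
            refine Finset.card_le_card fun i hi => ?_
            cases i with
            | zero =>
              cases l with
              | nil => simp [freshNeighbors, hD] at hs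
              | cons w l =>
                exact absurd ⟨v, w, rfl, rfl, (adj_or_stuck_of_mem_greedySeqs h).resolve_left hs⟩
                  (Finset.mem_filter.1 hi).2
            | succ i => exact hsucc i hi
        _ ≤ _ := by rw [Finset.card_map]; omega

/-- There are many vertex sequences through all vertices with few breaks. -/
theorem exists_many_seqs {N h β J : ℕ} (hD : 0 < D)
    (hN : ∀ b, (Finset.univ.filter fun v => color v = b).card = N)
    (hG : ∀ v w, G.Adj v w → color v ≠ color w)
    (hbad : open Classical in
      ∀ S : Finset V, (∀ b, h ≤ (S.filter fun v => color v = b).card) →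
      (Finset.univ.filter fun v => (S.filter fun w => G.Adj v w).card < D).card ≤ β)
    (hh : h ≤ N) (hJ : 2 * h + 1 + β ≤ J) :
    ∃ S : Finset (Fin (2 * N) ≃ V), (∀ a ∈ S, (breaks G a).card ≤ J) ∧
      D ^ (2 * N) ≤ S.card * D ^ J := by
  classical
  have hcard : Fintype.card V = 2 * N := by
    have := Finset.card_filter_add_card_filter_not (s := (Finset.univ : Finset V))
      (fun v => color v = true)
    simp only [Bool.not_eq_true, hN, Finset.card_univ] at this
    omega
  set T := greedySeqs G color D (2 * N) with hT
  have hequiv : ∀ l ∈ T, ∃ a : Fin (2 * N) ≃ V, List.ofFn a = l := by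
    intro l hl
    obtain ⟨h1, h2, -⟩ := greedySeqs_spec hG hl
    have hinj : Function.Injective fun i : Fin (2 * N) => l.get (i.cast h1.symm) := fun i j hij => by
      simpa using (List.nodup_iff_injective_get.1 h2) hij
    refine ⟨Equiv.ofBijective _ ((Fintype.bijective_iff_injective_and_card _).2
      ⟨hinj, by simp [hcard]⟩), ?_⟩
    refine List.ext_get (by simp [h1]) fun i hi hi' => ?_
    simp
  have : Nonempty (Fin (2 * N) ≃ V) := ⟨Fintype.equivOfCardEq (by simp [hcard])⟩
  choose! e he using hequiv
  refine ⟨T.image e, ?_, ?_⟩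
  · intro a ha
    obtain ⟨l, hl, rfl⟩ := Finset.mem_image.1 ha
    have hle := (card_nonadj_le_stuckCount hD hl).trans
      ((stuckCount_le hN hG hbad hh hl).trans hJ)
    refine le_trans ?_ hle
    rw [breaks, ← Finset.card_map Fin.valEmbedding]
    refine Finset.card_le_card fun i hi => ?_
    obtain ⟨j, hj, rfl⟩ := Finset.mem_map.1 hi
    have hlen := (greedySeqs_spec hG hl).1
    have hj := (Finset.mem_filter.1 hj).2
    refine Finset.mem_filter.2 ⟨by simp [hlen], ?_⟩
    rintro ⟨v, w, hv, hw, hvw⟩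
    rw [← he l hl] at hv hw
    simp only [Fin.valEmbedding_apply, List.getElem?_ofFn, Option.dite_none_right_eq_some,
      Option.some.injEq] at hv hw
    obtain ⟨_, rfl⟩ := hv
    obtain ⟨h, rfl⟩ := hw
    exact hj h hvw
  · rw [Finset.card_image_of_injOn fun l hl l' hl' h => by rw [← he l hl, ← he l' hl', h]]
    refine (pow_le_sum_greedySeqs hN hG le_rfl).trans ?_
    rw [← smul_eq_mul T.card, ← Finset.sum_const]
    exact Finset.sum_le_sum fun l hl => Nat.pow_le_pow_right hD
      ((stuckCount_le hN hG hbad hh hl).trans hJ)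

end Greedy

section Connectors

variable {V : Type}

/-- The position of `i` after inserting five new places after each element of `B`. -/
def gapPos {m : ℕ} (B : Finset (Fin m)) (i : ℕ) : ℕ := i + 5 * (B.filter fun j => j.val < i).card

theorem gapPos_zero {m : ℕ} (B : Finset (Fin m)) : gapPos B 0 = 0 := by simp [gapPos]

theorem gapPos_strictMono {m : ℕ} (B : Finset (Fin m)) : StrictMono (gapPos B) := by
  intro i j hij
  have : (B.filter fun k => k.val < i).card ≤ (B.filter fun k => k.val < j).card :=
    Finset.card_le_card (Finset.monotone_filter_right _ fun k _ hk => lt_trans hk hij)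
  unfold gapPos
  omega

theorem gapPos_succ_of_notMem {m : ℕ} {B : Finset (Fin m)} {i : Fin m} (hi : i ∉ B) :
    gapPos B (i.val + 1) = gapPos B i + 1 := by
  have : (B.filter fun k : Fin m => k.val < i.val + 1) = B.filter fun k : Fin m => k.val < i.val := by
    refine Finset.filter_congr fun k hk => ?_
    have : k.val ≠ i.val := fun h => hi (Fin.ext h ▸ hk)
    omega
  unfold gapPos
  rw [this]
  omega

theorem gapPos_succ_of_mem {m : ℕ} {B : Finset (Fin m)} {i : Fin m} (hi : i ∈ B) :
    gapPos B (i.val + 1) = gapPos B i + 6 := by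
  have : (B.filter fun k : Fin m => k.val < i.val + 1) =
      insert i (B.filter fun k : Fin m => k.val < i.val) := by
    ext k
    simp only [Finset.mem_filter, Finset.mem_insert, Fin.ext_iff]
    constructor
    · rintro ⟨hk, h⟩
      by_cases h' : k.val = i.val
      · exact Or.inl h'
      · exact Or.inr ⟨hk, by omega⟩
    · rintro (h | ⟨hk, h⟩)
      · exact ⟨Fin.ext h ▸ hi, by omega⟩
      · exact ⟨hk, by omega⟩
  unfold gapPos
  rw [this, Finset.card_insert_of_notMem (by simp)]
  omega

theorem gapPos_lt {m n : ℕ} {B : Finset (Fin m)} (hn : m + 5 * B.card ≤ n) (i : Fin m) :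
    gapPos B i < n := by
  have := Finset.card_filter_le B fun j => j.val < i
  have := i.isLt
  unfold gapPos
  omega

/-- The vertices of `V` together with the places among `n` which are not positions of elements
of `V`. -/
abbrev WithConnectors (V : Type) {m : ℕ} (B : Finset (Fin m)) (n : ℕ) : Type :=
  V ⊕ {k : Fin n // ∀ i : Fin m, gapPos B i ≠ k}

/-- The places of the vertices when connectors are inserted into a sequence. -/
noncomputable def placement {m n : ℕ} {B : Finset (Fin m)} (hn : m + 5 * B.card ≤ n)
    (a : Fin m ≃ V) : WithConnectors V B n ≃ Fin n :=
  Equiv.ofBijective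
    (Sum.elim (fun v => ⟨gapPos B (a.symm v), gapPos_lt hn _⟩) Subtype.val) <| by
  constructor
  · rintro (v | k) (w | l) h
    · have := (gapPos_strictMono B).injective (congrArg Fin.val h)
      simpa [Fin.val_inj] using this
    · exact absurd (congrArg Fin.val h) (l.2 _)
    · exact absurd (congrArg Fin.val h.symm) (k.2 _)
    · exact congrArg Sum.inr (Subtype.ext h)
  · intro k
    by_cases h : ∃ i : Fin m, gapPos B i = k
    · obtain ⟨i, hi⟩ := h
      exact ⟨Sum.inl (a i), Fin.ext (by simpa using hi)⟩
    · exact ⟨Sum.inr ⟨k, fun i hi => h ⟨i, hi⟩⟩, rfl⟩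

theorem placement_inl {m n : ℕ} {B : Finset (Fin m)} (hn : m + 5 * B.card ≤ n)
    (a : Fin m ≃ V) (v : V) : (placement hn a (Sum.inl v)).val = gapPos B (a.symm v) := rfl

theorem placement_inr {m n : ℕ} {B : Finset (Fin m)} (hn : m + 5 * B.card ≤ n)
    (a : Fin m ≃ V) (k : {k : Fin n // ∀ i : Fin m, gapPos B i ≠ k}) :
    placement hn a (Sum.inr k) = k.1 := rfl

theorem placement_injective {m n : ℕ} {B : Finset (Fin m)} (hn : m + 5 * B.card ≤ n) :
    Function.Injective (placement (V := V) hn) := by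
  intro a b h
  rw [← Equiv.symm_bijective.injective.eq_iff]
  ext v
  have := congrArg Fin.val (DFunLike.congr_fun h (Sum.inl v))
  rw [placement_inl, placement_inl] at this
  exact (gapPos_strictMono B).injective this

/-- The union of the paths obtained by inserting connectors into a family of sequences. -/
def connectedUnion {m n : ℕ} {B : Finset (Fin m)} (hn : m + 5 * B.card ≤ n)
    (S : Finset (Fin m ≃ V)) : SimpleGraph (WithConnectors V B n) where
  Adj y z := ∃ a ∈ S, (placement hn a y).val + 1 = placement hn a z ∨
    (placement hn a z).val + 1 = placement hn a y
  symm := ⟨fun _ _ ⟨a, ha, h⟩ => ⟨a, ha, h.symm⟩⟩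
  loopless := ⟨fun _ ⟨_, _, h⟩ => by omega⟩

/-- If sequences with the same breaks agree around the breaks, then inserting connectors at the
breaks creates no new 6-cycle. -/
theorem connectedUnion_C6_free {G : SimpleGraph V} (hG : ¬ ContainsCopy (cycleGraph 6) G)
    {m n : ℕ} {B : Finset (Fin m)} (hn : m + 5 * B.card ≤ n) {S : Finset (Fin m ≃ V)}
    (hB : ∀ a ∈ S, breaks G a = B)
    (hS : ∀ a ∈ S, ∀ b ∈ S, ∀ i ∈ B, a i = b i ∧
      ∀ h : i.val + 1 < m, a ⟨i.val + 1, h⟩ = b ⟨i.val + 1, h⟩) :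
    ¬ ContainsCopy (cycleGraph 6) (connectedUnion hn S) := by
  classical
  rintro ⟨f, hf⟩
  have h6 : ∀ j : Fin 6, j - 1 ≠ j + 1 := by decide
  have hadj (i : Fin 6) : (connectedUnion hn S).Adj (f i) (f (i + 1)) :=
    hf (by simp [cycleGraph_adj])
  -- an edge between two old vertices is an edge of `G`
  have hold : ∀ v w, (connectedUnion hn S).Adj (Sum.inl v) (Sum.inl w) → G.Adj v w := by
    have half : ∀ a ∈ S, ∀ v w, gapPos B (a.symm v) + 1 = gapPos B (a.symm w) → G.Adj v w := by
      intro a ha v w h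
      have hlt : (a.symm v).val < (a.symm w).val := (gapPos_strictMono B).lt_iff_lt.1 (by omega)
      have hle : gapPos B ((a.symm v).val + 1) ≤ gapPos B (a.symm w) :=
        (gapPos_strictMono B).monotone hlt
      have hnB : a.symm v ∉ B := by
        intro hv
        rw [gapPos_succ_of_mem hv] at hle
        omega
      have heq : (a.symm v).val + 1 = (a.symm w).val :=
        (gapPos_strictMono B).injective (by rw [gapPos_succ_of_notMem hnB, h])
      rw [← hB a ha, mem_breaks] at hnB
      simp only [not_forall, not_not] at hnB
      obtain ⟨h1, h2⟩ := hnB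
      have : (⟨(a.symm v).val + 1, h1⟩ : Fin m) = a.symm w := Fin.ext heq
      simpa [this] using h2
    rintro v w ⟨a, ha, h | h⟩
    · exact half a ha v w h
    · exact (half a ha w v h).symm
  by_cases hall : ∀ i, ∃ v, f i = Sum.inl v
  · choose g hg using hall
    refine hG ⟨⟨g, fun i j hij => f.injective (by rw [hg, hg, hij])⟩, fun i j hij => hold _ _ ?_⟩
    have := hf hij
    rwa [hg, hg] at this
  push Not at hall
  obtain ⟨j₀, hj₀⟩ := hall
  obtain ⟨a₀, ha₀, -⟩ := hadj 0
  -- the neighbours of a connector vertex do not depend on the sequence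
  have hnbr : ∀ y k, (connectedUnion hn S).Adj y (Sum.inr k) →
      (placement hn a₀ y).val + 1 = k.1 ∨ k.1.val + 1 = placement hn a₀ y := by
    rintro (v | l) k ⟨a, ha, h⟩
    · simp only [placement_inl, placement_inr] at h ⊢
      rcases h with h | h
      · left
        have hv : a.symm v ∈ B := by
          by_contra hv
          have hv' := hv
          rw [← hB a ha, mem_breaks] at hv'
          simp only [not_forall, not_not] at hv'
          exact k.2 ⟨_, hv'.1⟩ (by rw [← h, ← gapPos_succ_of_notMem hv])
        have := (hS a ha a₀ ha₀ _ hv).1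
        rw [Equiv.apply_symm_apply] at this
        rw [← h, this, Equiv.symm_apply_apply, ← this]
      · right
        have hpos : (a.symm v).val ≠ 0 := by
          intro h0
          rw [h0, gapPos_zero] at h
          omega
        obtain ⟨i, hi⟩ : ∃ i : Fin m, i.val + 1 = (a.symm v).val :=
          ⟨⟨(a.symm v).val - 1, by omega⟩, by simp; omega⟩
        have hiB : i ∈ B := by
          by_contra hiB
          have := gapPos_succ_of_notMem hiB
          rw [hi] at this
          exact k.2 i (by omega)
        have hlt : i.val + 1 < m := hi ▸ (a.symm v).isLt
        have := (hS a ha a₀ ha₀ _ hiB).2 hlt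
        have e : (⟨i.val + 1, hlt⟩ : Fin m) = a.symm v := Fin.ext hi
        rw [e, Equiv.apply_symm_apply] at this
        rw [h, this, Equiv.symm_apply_apply, ← this]
    · exact h
  have hboth : ∀ j k, f j = Sum.inr k →
      (∃ i, (placement hn a₀ (f i)).val + 1 = k.1) ∧
        ∃ i, k.1.val + 1 = placement hn a₀ (f i) := by
    intro j k hjk
    have h1 := hadj (j - 1)
    rw [sub_add_cancel, hjk] at h1
    have h2 := (hadj j).symm
    rw [hjk] at h2
    have hne : (placement hn a₀ (f (j - 1))).val ≠ placement hn a₀ (f (j + 1)) := by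
      exact fun h => h6 j (f.injective ((placement hn a₀).injective (Fin.ext h)))
    rcases hnbr _ _ h1 with h1 | h1 <;> rcases hnbr _ _ h2 with h2 | h2
    · omega
    · exact ⟨⟨_, h1⟩, ⟨_, h2⟩⟩
    · exact ⟨⟨_, h2⟩, ⟨_, h1⟩⟩
    · omega
  obtain ⟨j, hj, hmin⟩ := Finset.exists_min_image
    (Finset.univ.filter fun j => ∀ v, f j ≠ Sum.inl v) (fun j => (placement hn a₀ (f j)).val)
    ⟨j₀, by simpa using hj₀⟩
  obtain ⟨k, hk⟩ : ∃ k, f j = Sum.inr k := by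
    cases h : f j with
    | inl v => exact absurd h ((Finset.mem_filter.1 hj).2 v)
    | inr k => exact ⟨k, rfl⟩
  rw [hk, placement_inr] at hmin
  obtain ⟨i₀, hi₀⟩ := (hboth j k hk).1
  obtain ⟨v, hv⟩ : ∃ v, f i₀ = Sum.inl v := by
    by_contra! h
    have := hmin i₀ (by simpa using h)
    omega
  rw [hv, placement_inl] at hi₀
  have hvB : a₀.symm v ∈ B := by
    by_contra hvB
    have hv' := hvB
    rw [← hB a₀ ha₀, mem_breaks] at hv'
    simp only [not_forall, not_not] at hv'
    exact k.2 ⟨_, hv'.1⟩ (by rw [← hi₀, ← gapPos_succ_of_notMem hvB])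
  have hgap : ∀ t < 6, ∃ i, (placement hn a₀ (f i)).val = k.1.val + t := by
    intro t
    induction t with
    | zero => exact fun _ => ⟨j, by rw [hk, placement_inr, add_zero]⟩
    | succ t ih =>
      intro ht
      obtain ⟨i, hi⟩ := ih (by omega)
      cases h : f i with
      | inl w =>
        rw [h, placement_inl] at hi
        have h1 : (a₀.symm v).val < (a₀.symm w).val :=
          (gapPos_strictMono B).lt_iff_lt.1 (by omega)
        have h2 : gapPos B ((a₀.symm v).val + 1) ≤ gapPos B (a₀.symm w) :=
          (gapPos_strictMono B).monotone h1
        rw [gapPos_succ_of_mem hvB] at h2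
        omega
      | inr l =>
        rw [h, placement_inr] at hi
        obtain ⟨i', hi'⟩ := (hboth i l h).2
        exact ⟨i', by omega⟩
  have hcard : (Finset.Icc (gapPos B (a₀.symm v)) (gapPos B (a₀.symm v) + 6)).card ≤
      (Finset.univ.image fun i => (placement hn a₀ (f i)).val).card := by
    refine Finset.card_le_card fun x hx => ?_
    rw [Finset.mem_Icc] at hx
    simp only [Finset.mem_image, Finset.mem_univ, true_and]
    rcases eq_or_lt_of_le hx.1 with h | h
    · exact ⟨i₀, by rw [hv, placement_inl, h]⟩
    · obtain ⟨i, hi⟩ := hgap (x - k.1.val) (by omega)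
      exact ⟨i, by omega⟩
  have := Finset.card_image_le (s := Finset.univ) (f := fun i => (placement hn a₀ (f i)).val)
  rw [Nat.card_Icc] at hcard
  rw [Finset.card_univ, Fintype.card_fin] at this
  omega

/-- Among sequences with few breaks, many agree around their breaks. -/
theorem exists_agreeing (G : SimpleGraph V) {m J : ℕ} (hm : 0 < m) (S : Finset (Fin m ≃ V))
    (hS : S.Nonempty) (hJ : ∀ a ∈ S, (breaks G a).card ≤ J) :
    ∃ S' ⊆ S, ∃ B : Finset (Fin m), B.card ≤ J ∧ S.card ≤ S'.card * (m ^ 3) ^ J ∧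
      (∀ a ∈ S', breaks G a = B) ∧
      ∀ a ∈ S', ∀ b ∈ S', ∀ i ∈ B, a i = b i ∧
        ∀ h : i.val + 1 < m, a ⟨i.val + 1, h⟩ = b ⟨i.val + 1, h⟩ := by
  classical
  obtain ⟨a₁, ha₁⟩ := hS
  have : Fintype V := Fintype.ofEquiv _ a₁
  let nxt : (Fin m ≃ V) → Fin m → V := fun a i =>
    if h : i.val + 1 < m then a ⟨i.val + 1, h⟩ else a i
  let tri : (Fin m ≃ V) → Finset (Fin m × V × V) := fun a =>
    (breaks G a).image fun i => (i, a i, nxt a i)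
  have hex : ∀ a ∈ S, ∃ g : Fin J → Fin m × V × V, Finset.univ.image g = tri a := by
    intro a ha
    have hne : (tri a).Nonempty := by
      refine Finset.Nonempty.image ⟨⟨m - 1, by omega⟩, ?_⟩ _
      rw [mem_breaks]
      exact fun h => absurd h (by simp only; omega)
    have hle : Fintype.card (tri a) ≤ Fintype.card (Fin J) := by
      rw [Fintype.card_coe, Fintype.card_fin]
      exact Finset.card_image_le.trans (hJ a ha)
    obtain ⟨e⟩ := Function.Embedding.nonempty_of_card_le hle
    have : Nonempty (tri a) := hne.to_subtype
    refine ⟨fun j => (Function.invFun e j).1, ?_⟩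
    ext x
    simp only [Finset.mem_image, Finset.mem_univ, true_and]
    constructor
    · rintro ⟨j, rfl⟩
      exact (Function.invFun e j).2
    · intro hx
      obtain ⟨j, hj⟩ := Function.invFun_surjective e.injective ⟨x, hx⟩
      exact ⟨j, by rw [hj]⟩
  have : Nonempty (Fin J → Fin m × V × V) := ⟨(hex a₁ ha₁).choose⟩
  choose! g hg using hex
  obtain ⟨g₀, -, hg₀⟩ := Finset.exists_max_image (Finset.univ : Finset (Fin J → Fin m × V × V))
    (fun g' => (S.filter fun a => g a = g').card) Finset.univ_nonempty
  have hcard : S.card ≤ (S.filter fun a => g a = g₀).card * (m ^ 3) ^ J := by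
    rw [Finset.card_eq_sum_card_fiberwise (f := g) (t := Finset.univ)
      (fun _ _ => Finset.mem_coe.2 (Finset.mem_univ _))]
    refine (Finset.sum_le_sum fun g' _ => hg₀ g' (Finset.mem_univ _)).trans_eq ?_
    rw [Finset.sum_const, smul_eq_mul, mul_comm, Finset.card_univ]
    congr 1
    simp only [Fintype.card_fun, Fintype.card_prod, Fintype.card_fin, ← Fintype.card_congr a₁]
    ring
  have htri : ∀ a ∈ S.filter fun a => g a = g₀, tri a = Finset.univ.image g₀ := by
    intro a ha
    obtain ⟨haS, ha⟩ := Finset.mem_filter.1 ha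
    rw [← ha, hg a haS]
  have hbr : ∀ a, breaks G a = (tri a).image Prod.fst := by
    intro a
    simp only [tri, Finset.image_image]
    exact Finset.image_id.symm
  refine ⟨_, Finset.filter_subset (fun a => g a = g₀) S,
    (Finset.univ.image g₀).image Prod.fst, ?_, hcard, fun a ha => by rw [hbr, htri a ha], ?_⟩
  · exact Finset.card_image_le.trans (Finset.card_image_le.trans (by simp))
  · intro a ha b hb i hi
    rw [← htri a ha, ← hbr] at hi
    have h1 : (i, a i, nxt a i) ∈ tri b := by
      rw [htri b hb, ← htri a ha]
      exact Finset.mem_image_of_mem _ hi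
    obtain ⟨i', -, h⟩ := Finset.mem_image.1 h1
    simp only [Prod.mk.injEq] at h
    obtain ⟨rfl, h2, h3⟩ := h
    refine ⟨h2.symm, fun h => ?_⟩
    simp only [nxt, dif_pos h] at h3
    exact h3.symm

end Connectors

section Copies

/-- The disjoint union of `c` copies of a graph. -/
def copies {V : Type} (c : ℕ) (G : SimpleGraph V) : SimpleGraph (Fin c × V) where
  Adj x y := x.1 = y.1 ∧ G.Adj x.2 y.2
  symm := ⟨fun _ _ h => ⟨h.1.symm, h.2.symm⟩⟩
  loopless := ⟨fun _ h => G.loopless.irrefl _ h.2⟩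

theorem copies_C6_free {V : Type} (c : ℕ) {G : SimpleGraph V}
    (hG : ¬ ContainsCopy (cycleGraph 6) G) : ¬ ContainsCopy (cycleGraph 6) (copies c G) := by
  rintro ⟨f, hf⟩
  have h (i : Fin 6) : (f i).1 = (f (i + 1)).1 :=
    (hf (show (cycleGraph 6).Adj i (i + 1) by simp [cycleGraph_adj])).1
  have h0 : ∀ i, (f i).1 = (f 0).1 := by
    intro i
    induction i using Fin.induction with
    | zero => rfl
    | succ i ih => rw [← ih, ← Fin.coeSucc_eq_succ, ← h]
  exact hG ⟨⟨fun i => (f i).2, fun i j hij => f.injective (Prod.ext ((h0 i).trans (h0 j).symm) hij)⟩,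
    fun i j hij => (hf hij).2⟩

/-- The sequence through `c` copies of `V` obtained by concatenating sequences through `V`. -/
def concatSeqs {V : Type} {c m : ℕ} (s : Fin c → (Fin m ≃ V)) : Fin (c * m) ≃ Fin c × V :=
  finProdFinEquiv.symm.trans (Equiv.prodCongrRight s)

theorem concatSeqs_injective {V : Type} {c m : ℕ} :
    Function.Injective (concatSeqs (V := V) (c := c) (m := m)) := by
  intro s s' h
  ext i j
  have := DFunLike.congr_fun h (finProdFinEquiv (i, j))
  simpa [concatSeqs] using this

theorem card_breaks_concatSeqs_le {V : Type} {G : SimpleGraph V} {c m J : ℕ}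
    (s : Fin c → (Fin m ≃ V)) (hs : ∀ i, (breaks G (s i)).card ≤ J) :
    (breaks (copies c G) (concatSeqs s)).card ≤ c * J := by
  classical
  calc _ ≤ ((Finset.univ.sigma fun i => breaks G (s i)).image
        fun x : (_ : Fin c) × Fin m => finProdFinEquiv (x.1, x.2)).card := by
        refine Finset.card_le_card fun x hx => ?_
        obtain ⟨⟨i, j⟩, rfl⟩ := finProdFinEquiv.surjective x
        refine Finset.mem_image.2 ⟨⟨i, j⟩, Finset.mem_sigma.2 ⟨Finset.mem_univ _, ?_⟩, rfl⟩
        rw [mem_breaks] at hx ⊢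
        intro h hadj
        have hval : (finProdFinEquiv (i, (⟨j.val + 1, h⟩ : Fin m))).val =
            (finProdFinEquiv (i, j)).val + 1 := by
          simp only [finProdFinEquiv_apply_val]
          ring
        have hlt : (finProdFinEquiv (i, j)).val + 1 < c * m := hval ▸ Fin.isLt _
        refine hx hlt ?_
        have e : (⟨(finProdFinEquiv (i, j)).val + 1, hlt⟩ : Fin (c * m)) =
            finProdFinEquiv (i, (⟨j.val + 1, h⟩ : Fin m)) := Fin.ext hval.symm
        rw [e]
        simpa [concatSeqs, copies] using hadj
    _ ≤ (Finset.univ.sigma fun i => breaks G (s i)).card := Finset.card_image_le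
    _ ≤ ∑ _i : Fin c, J := by
        rw [Finset.card_sigma]
        exact Finset.sum_le_sum fun i _ => hs i
    _ = c * J := by simp

end Copies

section Families

/-- A family of Hamilton paths pairwise creating a 6-cycle and a family of paths inside a graph
without 6-cycles have sizes whose product is at most `n!`. -/
theorem card_mul_card_le_factorial {n m : ℕ}
    (P : Fin m → Σ u : Fin n, Σ v : Fin n, (⊤ : SimpleGraph (Fin n)).Walk u v)
    (hham : ∀ i, (P i).2.2.IsHamiltonian)
    (hP : ∀ i j, i ≠ j → ContainsCopy (cycleGraph 6) (walkUnion (P i).2.2 (P j).2.2))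
    {Y : Type} (H : SimpleGraph Y) (hH : ¬ ContainsCopy (cycleGraph 6) H)
    (T : Finset (Y ≃ Fin n))
    (hT : ∀ τ ∈ T, ∀ y z, (τ y).val + 1 = τ z → H.Adj y z) :
    m * T.card ≤ n.factorial := by
  classical
  rcases T.eq_empty_or_nonempty with rfl | ⟨τ₀, hτ₀⟩
  · simp
  have hbij : ∀ i, Function.Bijective fun k : Fin n => (P i).2.2.getVert k := by
    intro i
    refine (Finite.injective_iff_bijective).1 fun k l hkl => ?_
    have hlen : (P i).2.2.length = n - 1 := by
      rw [(hham i).length_eq, Fintype.card_fin]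
    exact Fin.ext ((hham i).isPath.getVert_injOn (by simp; omega) (by simp; omega) hkl)
  let w : Fin m → (Fin n ≃ Fin n) := fun i => Equiv.ofBijective _ (hbij i)
  have hedge : ∀ i, ∀ τ ∈ T, ∀ x y, (P i).2.2.toSubgraph.Adj x y →
      H.Adj ((τ.trans (w i)).symm x) ((τ.trans (w i)).symm y) := by
    have half : ∀ i, ∀ τ ∈ T, ∀ k, k < (P i).2.2.length →
        H.Adj ((τ.trans (w i)).symm ((P i).2.2.getVert k))
          ((τ.trans (w i)).symm ((P i).2.2.getVert (k + 1))) := by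
      intro i τ hτ k hk
      have hlen : (P i).2.2.length = n - 1 := by
        rw [(hham i).length_eq, Fintype.card_fin]
      have e1 : (P i).2.2.getVert k = w i ⟨k, by omega⟩ := rfl
      have e2 : (P i).2.2.getVert (k + 1) = w i ⟨k + 1, by omega⟩ := rfl
      refine hT τ hτ _ _ ?_
      rw [e1, e2]
      simp
    intro i τ hτ x y hxy
    obtain ⟨k, h, hk⟩ := (Walk.toSubgraph_adj_iff _).1 hxy
    rcases Sym2.eq_iff.1 h with ⟨rfl, rfl⟩ | ⟨rfl, rfl⟩
    · exact half i τ hτ k hk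
    · exact (half i τ hτ k hk).symm
  have hinj : Set.InjOn (fun x : Fin m × (Y ≃ Fin n) => x.2.trans (w x.1))
      (Finset.univ ×ˢ T : Finset (Fin m × (Y ≃ Fin n))) := by
    rintro ⟨i, τ⟩ hi ⟨j, τ'⟩ hj h
    simp only [Finset.coe_product, Set.mem_prod, Finset.mem_coe] at hi hj h
    have hij : i = j := by
      by_contra hij
      obtain ⟨f, hf⟩ := hP i j hij
      refine hH ⟨f.trans (τ.trans (w i)).symm.toEmbedding, fun a b hab => ?_⟩
      have := hf hab
      simp only [walkUnion, Subgraph.spanningCoe_adj, Subgraph.sup_adj] at this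
      rcases this with h' | h'
      · exact hedge i τ hi.2 _ _ h'
      · simp only [h]
        exact hedge j τ' hj.2 _ _ h'
    subst hij
    refine Prod.ext rfl ?_
    ext y
    have := DFunLike.congr_fun h y
    exact congrArg Fin.val (by simpa using this)
  have : Fintype Y := Fintype.ofEquiv _ τ₀.symm
  calc m * T.card = (Finset.univ ×ˢ T : Finset (Fin m × (Y ≃ Fin n))).card := by
        rw [Finset.card_product, Finset.card_univ, Fintype.card_fin]
    _ ≤ (Finset.univ : Finset (Y ≃ Fin n)).card :=
        Finset.card_le_card_of_injOn _ (fun _ _ => Finset.mem_coe.2 (Finset.mem_univ _)) hinj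
    _ = n.factorial := by
        rw [Finset.card_univ, Fintype.card_equiv τ₀, Fintype.card_congr τ₀, Fintype.card_fin]

end Families

section Bounds

variable {n m : ℕ} {P : Fin m → Σ u : Fin n, Σ v : Fin n, (⊤ : SimpleGraph (Fin n)).Walk u v}

/-- Many sequences with few breaks through the vertices of a graph without 6-cycles give an upper
bound for the size of a family of Hamilton paths pairwise creating a 6-cycle. -/
theorem mul_pow_le_of_many_seqs (hham : ∀ i, (P i).2.2.IsHamiltonian)
    (hP : ∀ i j, i ≠ j → ContainsCopy (cycleGraph 6) (walkUnion (P i).2.2 (P j).2.2))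
    {V : Type} {G : SimpleGraph V} (hG : ¬ ContainsCopy (cycleGraph 6) G)
    {M J D c : ℕ} (hM : 0 < M) (hD : 0 < D) (hDn : D ≤ n) (hc : 0 < c)
    (S : Finset (Fin M ≃ V)) (hS : ∀ a ∈ S, (breaks G a).card ≤ J)
    (hcard : D ^ M ≤ S.card * D ^ J) (hn : c * M + 5 * (c * J) ≤ n) :
    m * D ^ (c * M) ≤ n ^ (n + 4 * (c * J)) := by
  classical
  let S₀ : Finset (Fin (c * M) ≃ Fin c × V) :=
    (Fintype.piFinset fun _ : Fin c => S).image concatSeqs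
  have hS₀ : S₀.card = S.card ^ c := by
    rw [Finset.card_image_of_injective _ concatSeqs_injective, Fintype.card_piFinset]
    simp
  have hpos : 0 < S.card := by
    have : 0 < D ^ M := by positivity
    exact Nat.pos_of_ne_zero fun h => by simp [h] at hcard; omega
  have hne : S₀.Nonempty := by
    rw [← Finset.card_pos, hS₀]
    positivity
  have hbr : ∀ a ∈ S₀, (breaks (copies c G) a).card ≤ c * J := by
    intro a ha
    obtain ⟨s, hs, rfl⟩ := Finset.mem_image.1 ha
    exact card_breaks_concatSeqs_le s fun i => hS _ (Fintype.mem_piFinset.1 hs i)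
  obtain ⟨S', -, B, hB, hle, hS'B, hS'⟩ :=
    exists_agreeing (copies c G) (by positivity) S₀ hne hbr
  have hn' : c * M + 5 * B.card ≤ n := by omega
  have hfam := card_mul_card_le_factorial P hham hP (connectedUnion hn' S')
    (connectedUnion_C6_free (copies_C6_free c hG) hn' hS'B hS')
    (S'.map ⟨placement hn', placement_injective hn'⟩) (by
      intro τ hτ y z h
      obtain ⟨a, ha, rfl⟩ := Finset.mem_map.1 hτ
      exact ⟨a, ha, Or.inl h⟩)
  rw [Finset.card_map] at hfam
  have hcM : c * M ≤ n := by omega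
  calc m * D ^ (c * M) = m * (D ^ M) ^ c := by rw [mul_comm c, pow_mul]
    _ ≤ m * (S.card * D ^ J) ^ c := by gcongr
    _ = m * S₀.card * D ^ (c * J) := by rw [mul_pow, hS₀, ← pow_mul, mul_comm J, mul_assoc]
    _ ≤ m * (S'.card * ((c * M) ^ 3) ^ (c * J)) * D ^ (c * J) := by gcongr
    _ = m * S'.card * ((c * M) ^ 3) ^ (c * J) * D ^ (c * J) := by ring
    _ ≤ n.factorial * (n ^ 3) ^ (c * J) * n ^ (c * J) := by gcongr
    _ ≤ n ^ n * (n ^ 3) ^ (c * J) * n ^ (c * J) := by gcongr; exact n.factorial_le_pow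
    _ = n ^ (n + 4 * (c * J)) := by rw [← pow_mul, ← pow_add, ← pow_add]; ring_nf

theorem exists_mul_pow_le {p k : ℕ} (hp : p.Prime) (hk : 2 ≤ k) (hkp : 48 * k ^ 4 ≤ p) :
    ∃ J, k * J ≤ 5 * p ^ 3 ∧ ∀ {n m : ℕ}
      {P : Fin m → Σ u : Fin n, Σ v : Fin n, (⊤ : SimpleGraph (Fin n)).Walk u v},
      (∀ i, (P i).2.2.IsHamiltonian) →
      (∀ i j, i ≠ j → ContainsCopy (cycleGraph 6) (walkUnion (P i).2.2 (P j).2.2)) →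
      ∀ c, 0 < c → c * (2 * p ^ 3) + 5 * (c * J) ≤ n →
        m * (p / (2 * k)) ^ (c * (2 * p ^ 3)) ≤ n ^ (n + 4 * (c * J)) := by
  classical
  have : Fact p.Prime := ⟨hp⟩
  have hp0 : 0 < p := hp.pos
  have hkp' : 48 * k ≤ p := le_trans (by gcongr; exact Nat.le_self_pow (by norm_num) k) hkp
  have hpN : p ≤ p ^ 3 := Nat.le_self_pow (by norm_num) p
  have hdiv : k * (p ^ 3 / k) ≤ p ^ 3 := Nat.mul_div_le _ _
  have hdiv' : k * (2 * p ^ 3 / k) ≤ 2 * p ^ 3 := Nat.mul_div_le _ _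
  have hD : 0 < p / (2 * k) := Nat.div_pos (by omega) (by omega)
  have hN : ∀ b, (Finset.univ.filter fun v : (ZMod p × ZMod p × ZMod p) ⊕
      (ZMod p × ZMod p × ZMod p) => v.isLeft = b).card = p ^ 3 := by
    intro b
    rw [Finset.card_filter, Fintype.sum_sum_type]
    cases b <;> simp <;> ring
  have hadj : ∀ v w, (incidenceGraph (ZMod p)).Adj v w → v.isLeft ≠ w.isLeft := by
    rintro (v | v) (w | w) h <;> simp_all [incidenceGraph]
  have hbad : open Classical in
      ∀ S : Finset ((ZMod p × ZMod p × ZMod p) ⊕ (ZMod p × ZMod p × ZMod p)),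
      (∀ b, p ^ 3 / k + 1 ≤ (S.filter fun v => v.isLeft = b).card) →
      (Finset.univ.filter fun v =>
        (S.filter fun w => (incidenceGraph (ZMod p)).Adj v w).card < p / (2 * k)).card ≤
          2 * p ^ 3 / k := by
    intro S hS
    rw [Nat.le_div_iff_mul_le (by omega)]
    have h := incidenceGraph_few_bad (F := ZMod p) (k := k) (h := p ^ 3 / k + 1)
      (D := p / (2 * k)) ?_ ?_ ?_ S ?_
    · rw [ZMod.card] at h
      convert h
    · rwa [ZMod.card]
    · rw [ZMod.card]
      exact (Nat.lt_mul_div_succ _ (by omega)).le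
    · rw [ZMod.card]
      refine le_trans ?_ (Nat.le_succ _)
      rw [Nat.le_div_iff_mul_le (by omega)]
      calc 2 * p ^ 2 * (p / (2 * k)) * k = p ^ 2 * (2 * k * (p / (2 * k))) := by ring
        _ ≤ p ^ 2 * p := by gcongr; exact Nat.mul_div_le _ _
        _ = p ^ 3 := by ring
    · convert hS
  have hh : p ^ 3 / k + 1 ≤ p ^ 3 := by
    have : 2 * (p ^ 3 / k) ≤ k * (p ^ 3 / k) := by gcongr
    omega
  obtain ⟨S, hS, hcard⟩ := exists_many_seqs hD hN hadj hbad hh le_rfl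
  refine ⟨2 * (p ^ 3 / k + 1) + 1 + 2 * p ^ 3 / k, ?_, fun hham hP c hc hn => ?_⟩
  · calc _ = 2 * (k * (p ^ 3 / k)) + 3 * k + k * (2 * p ^ 3 / k) := by ring
      _ ≤ _ := by omega
  · refine mul_pow_le_of_many_seqs hham hP incidenceGraph_C6_free (by positivity) hD ?_ hc S hS
      hcard hn
    calc p / (2 * k) ≤ p := Nat.div_le_self _ _
      _ ≤ 1 * (2 * p ^ 3) := by omega
      _ ≤ c * (2 * p ^ 3) := by gcongr; exact hc
      _ ≤ _ := by omega

end Bounds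

section Asymptotics

open Filter

theorem le_rpow_of_mul_pow_le {n m D A E : ℕ} {b X : ℝ} (hn : 0 < n)
    (h : m * D ^ A ≤ n ^ E) (hD : (n : ℝ) ^ b ≤ D) (hX : E - b * A ≤ X) :
    (m : ℝ) ≤ (n : ℝ) ^ X := by
  have hn' : (0 : ℝ) < n := by exact_mod_cast hn
  have hn1 : (1 : ℝ) ≤ n := by exact_mod_cast hn
  refine le_trans ?_ (Real.rpow_le_rpow_of_exponent_le hn1 hX)
  rw [Real.rpow_sub hn', le_div_iff₀ (by positivity), Real.rpow_natCast, Real.rpow_mul hn'.le,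
    Real.rpow_natCast]
  calc (m : ℝ) * ((n : ℝ) ^ b) ^ A ≤ m * (D : ℝ) ^ A := by gcongr
    _ ≤ (n : ℝ) ^ E := by exact_mod_cast h

theorem exists_prime_near_rpow {n : ℕ} {a : ℝ} (ha : 1 ≤ (n : ℝ) ^ a) :
    ∃ p : ℕ, p.Prime ∧ (n : ℝ) ^ a ≤ p ∧ (p : ℝ) ≤ 4 * (n : ℝ) ^ a := by
  have hpos : 0 < (n : ℝ) ^ a := by linarith
  obtain ⟨p, hp, h1, h2⟩ :=
    Nat.exists_prime_lt_and_le_two_mul ⌈(n : ℝ) ^ a⌉₊ (Nat.ceil_pos.2 hpos).ne'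
  have h3 := Nat.ceil_lt_add_one hpos.le
  have h2' : (p : ℝ) ≤ 2 * (⌈(n : ℝ) ^ a⌉₊ : ℝ) := by exact_mod_cast h2
  exact ⟨p, hp, Nat.ceil_le.1 h1.le, by linarith⟩

theorem half_div_le_natCast_div {p d : ℕ} (hd : 0 < d) (hdp : d ≤ p) :
    (p : ℝ) / (2 * d) ≤ ((p / d : ℕ) : ℝ) := by
  have hd' : (0 : ℝ) < d := by exact_mod_cast hd
  rw [div_le_iff₀ (by positivity)]
  have h1 := Nat.lt_mul_div_succ p hd
  have h2 : 1 ≤ p / d := Nat.div_pos hdp hd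
  have : p ≤ (p / d) * (2 * d) := by nlinarith
  exact_mod_cast this

/-- With `c` chosen as large as possible, the exponents in `exists_mul_pow_le` are as desired. -/
theorem exponent_le {n N J k c : ℕ} {e : ℝ} (he : 0 < e) (he' : e ≤ 1 / 3) (hk : 60 / e ≤ k)
    (hJ : k * J ≤ 5 * N) (hN : (N : ℝ) ≤ e / 36 * n) (hc : c * (2 * N) + 5 * (c * J) ≤ n)
    (hc' : n ≤ (c + 1) * (2 * N + 5 * J)) :
    ((n + 4 * (c * J) : ℕ) : ℝ) - (1 / 3 - e / 4) * (c * (2 * N) : ℕ) ≤ (2 / 3 + e) * n := by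
  have hk0 : (0 : ℝ) < k := lt_of_lt_of_le (by positivity) hk
  rw [div_le_iff₀ he] at hk
  have hJ' : (k : ℝ) * J ≤ 5 * N := by exact_mod_cast hJ
  have hc1 : (c : ℝ) * (2 * N) + 5 * (c * J) ≤ n := by exact_mod_cast hc
  have hc2 : (n : ℝ) ≤ (c + 1) * (2 * N + 5 * J) := by exact_mod_cast hc'
  push_cast
  have hJ0 : (0 : ℝ) ≤ J := J.cast_nonneg
  have hN0 : (0 : ℝ) ≤ N := N.cast_nonneg
  have hc0 : (0 : ℝ) ≤ c := c.cast_nonneg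
  have hJN : 12 * (J : ℝ) ≤ e * N := by
    have : 60 * (J : ℝ) ≤ 5 * (e * N) := by
      calc 60 * (J : ℝ) ≤ k * e * J := by gcongr
        _ = e * (k * J) := by ring
        _ ≤ e * (5 * N) := by gcongr
        _ = _ := by ring
    linarith
  have hcJ : 24 * ((c : ℝ) * J) ≤ e * n := by
    calc 24 * ((c : ℝ) * J) = 2 * c * (12 * J) := by ring
      _ ≤ 2 * c * (e * N) := by gcongr
      _ = e * (c * (2 * N)) := by ring
      _ ≤ e * n := by
        gcongr
        nlinarith [mul_nonneg hc0 hJ0]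
  have hJN' : (J : ℝ) ≤ N := by nlinarith
  have hlow : (n : ℝ) * (1 - e / 4 - 7 * e / 36) ≤ c * (2 * N) := by nlinarith
  have hb : 0 ≤ 1 / 3 - e / 4 := by linarith
  have h1 := mul_le_mul_of_nonneg_left hlow hb
  have hn0 : (0 : ℝ) ≤ n := n.cast_nonneg
  nlinarith [mul_nonneg hn0 he.le, mul_nonneg hn0 (mul_nonneg he.le he.le)]

theorem exists_parameters {e : ℝ} (he : 0 < e) (he' : e ≤ 1 / 3) :
    ∃ n₀ k : ℕ, 0 < n₀ ∧ 2 ≤ k ∧ 60 / e ≤ k ∧ ∀ n, n₀ ≤ n → ∃ p : ℕ, p.Prime ∧ 48 * k ^ 4 ≤ p ∧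
      (n : ℝ) ^ (1 / 3 - e / 4) ≤ (p / (2 * k) : ℕ) ∧ ((p ^ 3 : ℕ) : ℝ) ≤ e / 36 * n := by
  obtain ⟨k, hk⟩ := exists_nat_ge (60 / e)
  have hk2 : 2 ≤ k := by
    have : (2 : ℝ) ≤ k := by
      refine le_trans ?_ hk
      rw [le_div_iff₀ he]
      linarith
    exact_mod_cast this
  have key : ∀ a : ℝ, 0 < a → ∀ C : ℝ, ∀ᶠ n : ℕ in atTop, C ≤ (n : ℝ) ^ a := fun a ha C =>
    ((tendsto_rpow_atTop ha).comp tendsto_natCast_atTop_atTop).eventually_ge_atTop C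
  obtain ⟨n₀, hn₀⟩ := eventually_atTop.1
    ((key (1 / 3 - e / 8) (by linarith) (48 * k ^ 4)).and
      ((key (3 * e / 8) (by linarith) (64 * 36 / e)).and (key (e / 8) (by linarith) (4 * k))))
  refine ⟨n₀ + 1, k, by omega, hk2, hk, fun n hn => ?_⟩
  obtain ⟨h1, h2, h3⟩ := hn₀ n (by omega)
  have hn0 : (0 : ℝ) < n := by
    have : 0 < n := by omega
    exact_mod_cast this
  have hk1 : (1 : ℝ) ≤ k := by exact_mod_cast (by omega : 1 ≤ k)
  obtain ⟨p, hp, hp1, hp2⟩ := exists_prime_near_rpow (n := n) (a := 1 / 3 - e / 8)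
    (le_trans (by nlinarith [one_le_pow₀ hk1 (n := 4)]) h1)
  have hkp : 48 * k ^ 4 ≤ p := by exact_mod_cast h1.trans hp1
  have hkp' : 48 * k ≤ p := le_trans (by gcongr; exact Nat.le_self_pow (by norm_num) k) hkp
  refine ⟨p, hp, hkp, ?_, ?_⟩
  · refine le_trans ?_ (half_div_le_natCast_div (by omega) (by omega))
    push_cast
    rw [le_div_iff₀ (by positivity)]
    calc (n : ℝ) ^ (1 / 3 - e / 4) * (2 * (2 * k)) = (n : ℝ) ^ (1 / 3 - e / 4) * (4 * k) := by ring
      _ ≤ (n : ℝ) ^ (1 / 3 - e / 4) * (n : ℝ) ^ (e / 8) := by gcongr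
      _ = (n : ℝ) ^ (1 / 3 - e / 8) := by rw [← Real.rpow_add hn0]; ring_nf
      _ ≤ p := hp1
  · have hz : (((n : ℝ) ^ (1 / 3 - e / 8)) ^ 3) * (n : ℝ) ^ (3 * e / 8) = n := by
      rw [← Real.rpow_natCast, ← Real.rpow_mul hn0.le, ← Real.rpow_add hn0]
      convert Real.rpow_one (n : ℝ) using 2
      push_cast
      ring
    rw [div_le_iff₀ he] at h2
    push_cast
    calc (p : ℝ) ^ 3 ≤ (4 * (n : ℝ) ^ (1 / 3 - e / 8)) ^ 3 := by gcongr
      _ = ((n : ℝ) ^ (1 / 3 - e / 8)) ^ 3 * (64 * 36) / 36 := by ring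
      _ ≤ ((n : ℝ) ^ (1 / 3 - e / 8)) ^ 3 * ((n : ℝ) ^ (3 * e / 8) * e) / 36 := by gcongr
      _ = e / 36 * (((n : ℝ) ^ (1 / 3 - e / 8)) ^ 3 * (n : ℝ) ^ (3 * e / 8)) := by ring
      _ = e / 36 * n := by rw [hz]

end Asymptotics

/-- For every `ε > 0` there is `n₀` such that for all `n ≥ n₀`, any family of `m` distinct
Hamilton paths in `K_n` such that the union of any two distinct members contains a `6`-cycle
satisfies `m ≤ n ^ ((2/3 + ε) n)`; i.e. `H_n(C₆) ≤ n ^ ((2/3) n + o(n))`. -/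
theorem Hn_C6_upper :
    ∀ ε : ℝ, 0 < ε → ∃ n₀ : ℕ, ∀ n : ℕ, n₀ ≤ n →
      ∀ (m : ℕ) (P : Fin m → Σ u : Fin n, Σ v : Fin n, (⊤ : SimpleGraph (Fin n)).Walk u v),
        Function.Injective P →
        (∀ i, (P i).2.2.IsHamiltonian) →
        (∀ i j, i ≠ j → ContainsCopy (cycleGraph 6) (walkUnion (P i).2.2 (P j).2.2)) →
        (m : ℝ) ≤ (n : ℝ) ^ ((2 / 3 + ε) * n) := by
  intro ε hε
  obtain ⟨n₀, k, hn₀, hk, hk', h⟩ := exists_parameters (e := min ε (1 / 3)) (by positivity)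
    (min_le_right _ _)
  refine ⟨n₀, fun n hn m P _ hham hP => ?_⟩
  obtain ⟨p, hp, hkp, hD, hN⟩ := h n hn
  obtain ⟨J, hJ, hbound⟩ := exists_mul_pow_le hp hk hkp
  have hp0 : 0 < p ^ 3 := pow_pos hp.pos 3
  set c := n / (2 * p ^ 3 + 5 * J) with hc
  have hcn : c * (2 * p ^ 3) + 5 * (c * J) ≤ n := by
    have := Nat.div_mul_le_self n (2 * p ^ 3 + 5 * J)
    rw [← hc] at this
    linarith
  have hcn' : n ≤ (c + 1) * (2 * p ^ 3 + 5 * J) := by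
    rw [mul_comm]
    exact (Nat.lt_mul_div_succ n (by omega)).le
  have hexp := exponent_le (by positivity) (min_le_right ε (1 / 3)) hk' hJ hN hcn hcn'
  have hcpos : 0 < c := by
    refine Nat.div_pos ?_ (by omega)
    have : ((p ^ 3 : ℕ) : ℝ) ≤ 1 / 3 / 36 * n := hN.trans (by gcongr; exact min_le_right _ _)
    have : 108 * p ^ 3 ≤ n := by
      have : 108 * ((p ^ 3 : ℕ) : ℝ) ≤ n := by linarith
      exact_mod_cast this
    have : 2 * J ≤ k * J := by gcongr
    omega
  refine (le_rpow_of_mul_pow_le (by omega) (hbound hham hP c hcpos hcn) hD hexp).trans ?_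
  refine Real.rpow_le_rpow_of_exponent_le (by exact_mod_cast (by omega : 1 ≤ n)) ?_
  gcongr
  exact min_le_left _ _
end

section
/- For every ε > 0 there exists n₀ such that for all integers n ≥ n₀, H_n(C_8) ≤ n^{(4/5 + ε)n}; that is, the maximum size of a family of Hamilton paths in K_n the union of any two of which contains an 8-cycle is at most n^{(4/5)n + o(n)}. -/
open SimpleGraph

section ClosedWalks

lemma exists_closed_walk_of_containsCopy {V : Type*} {G : SimpleGraph V}
    (h : ContainsCopy (cycleGraph 8) G) :
    ∃ f : Fin 8 → V, Function.Injective f ∧ ∀ i, G.Adj (f i) (f (i + 1)) := by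
  obtain ⟨f, hf⟩ := h
  refine ⟨f, f.injective, fun i => hf ?_⟩
  revert i
  decide

lemma containsCopy_of_closed_walk {V : Type*} {G : SimpleGraph V} {f : Fin 8 → V}
    (hf : Function.Injective f) (h : ∀ i, G.Adj (f i) (f (i + 1))) :
    ContainsCopy (cycleGraph 8) G := by
  refine ⟨⟨f, hf⟩, fun a b hab => ?_⟩
  have : b = a + 1 ∨ a = b + 1 := by
    revert a b
    decide
  rcases this with rfl | rfl
  · exact h a
  · exact (h b).symm

end ClosedWalks

section Incidence

variable {F : Type*} [Field F]

/-- The incidence relation of the graph `D(5, F)` of Lazebnik and Ustimenko, between the point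
with coordinates `a, p` and the line with coordinates `b, l`. -/
def Incident (a : F) (p : F × F × F × F) (b : F) (l : F × F × F × F) : Prop :=
  p.1 + l.1 = a * b ∧ p.2.1 + l.2.1 = a * l.1 ∧ p.2.2.1 + l.2.2.1 = b * p.1 ∧
    p.2.2.2 + l.2.2.2 = b * p.2.1

lemma exists_incident_line_iff (a : F) (p : F × F × F × F) (b : F) :
    ∃ l₀, ∀ l, Incident a p b l ↔ l = l₀ := by
  refine ⟨(a * b - p.1, a * (a * b - p.1) - p.2.1, b * p.1 - p.2.2.1, b * p.2.1 - p.2.2.2), ?_⟩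
  rintro ⟨l₁, l₂, l₃, l₄⟩
  simp only [Incident, Prod.mk.injEq]
  constructor
  · rintro ⟨h1, h2, h3, h4⟩
    have h1' := eq_sub_of_add_eq' h1
    subst h1'
    exact ⟨rfl, eq_sub_of_add_eq' h2, eq_sub_of_add_eq' h3, eq_sub_of_add_eq' h4⟩
  · rintro ⟨rfl, rfl, rfl, rfl⟩
    refine ⟨?_, ?_, ?_, ?_⟩ <;> ring

lemma exists_incident_point_iff (a b : F) (l : F × F × F × F) :
    ∃ p₀, ∀ p, Incident a p b l ↔ p = p₀ := by
  refine ⟨(a * b - l.1, a * l.1 - l.2.1, b * (a * b - l.1) - l.2.2.1,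
    b * (a * l.1 - l.2.1) - l.2.2.2), ?_⟩
  rintro ⟨p₁, p₂, p₃, p₄⟩
  simp only [Incident, Prod.mk.injEq]
  constructor
  · rintro ⟨h1, h2, h3, h4⟩
    have h1' := eq_sub_of_add_eq h1
    have h2' := eq_sub_of_add_eq h2
    subst h1' h2'
    exact ⟨rfl, rfl, eq_sub_of_add_eq h3, eq_sub_of_add_eq h4⟩
  · rintro ⟨rfl, rfl, rfl, rfl⟩
    refine ⟨?_, ?_, ?_, ?_⟩ <;> ring

lemma Incident.point_unique {a b : F} {p p' l : F × F × F × F} (h : Incident a p b l)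
    (h' : Incident a p' b l) : p = p' := by
  obtain ⟨p₀, hp⟩ := exists_incident_point_iff a b l
  rw [(hp p).1 h, (hp p').1 h']

lemma Incident.line_unique {a b : F} {p l l' : F × F × F × F} (h : Incident a p b l)
    (h' : Incident a p b l') : l = l' := by
  obtain ⟨l₀, hl⟩ := exists_incident_line_iff a p b
  rw [(hl l).1 h, (hl l').1 h']

/-- A closed walk of length eight in the incidence graph degenerates. -/
lemma incident_octagon {a₁ a₂ a₃ a₄ b₁ b₂ b₃ b₄ : F}
    {p₁ p₂ p₃ p₄ l₁ l₂ l₃ l₄ : F × F × F × F}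
    (h₁₁ : Incident a₁ p₁ b₁ l₁) (h₂₁ : Incident a₂ p₂ b₁ l₁) (h₂₂ : Incident a₂ p₂ b₂ l₂)
    (h₃₂ : Incident a₃ p₃ b₂ l₂) (h₃₃ : Incident a₃ p₃ b₃ l₃) (h₄₃ : Incident a₄ p₄ b₃ l₃)
    (h₄₄ : Incident a₄ p₄ b₄ l₄) (h₁₄ : Incident a₁ p₁ b₄ l₄)
    (ha₂₃ : a₂ ≠ a₃) (ha₃₄ : a₃ ≠ a₄) (hb₂₃ : b₂ ≠ b₃) (hb₃₄ : b₃ ≠ b₄) : False := by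
  obtain ⟨p₁, q₁, r₁, s₁⟩ := p₁
  obtain ⟨p₂, q₂, r₂, s₂⟩ := p₂
  obtain ⟨p₃, q₃, r₃, s₃⟩ := p₃
  obtain ⟨p₄, q₄, r₄, s₄⟩ := p₄
  obtain ⟨l₁, m₁, n₁, o₁⟩ := l₁
  obtain ⟨l₂, m₂, n₂, o₂⟩ := l₂
  obtain ⟨l₃, m₃, n₃, o₃⟩ := l₃
  obtain ⟨l₄, m₄, n₄, o₄⟩ := l₄
  simp only [Incident] at *
  obtain ⟨x1, y1, z1, w1⟩ := h₁₁
  obtain ⟨x2, y2, z2, w2⟩ := h₂₁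
  obtain ⟨x3, y3, z3, w3⟩ := h₂₂
  obtain ⟨x4, y4, z4, w4⟩ := h₃₂
  obtain ⟨x5, y5, z5, w5⟩ := h₃₃
  obtain ⟨x6, y6, z6, w6⟩ := h₄₃
  obtain ⟨x7, y7, z7, w7⟩ := h₄₄
  obtain ⟨x8, y8, z8, w8⟩ := h₁₄
  have e1 : (a₁ - a₂) * b₁ + (a₂ - a₃) * b₂ + (a₃ - a₄) * b₃ + (a₄ - a₁) * b₄ = 0 := by
    linear_combination -x1 + x2 - x3 + x4 - x5 + x6 - x7 + x8
  have e2 : (a₁ - a₂) * l₁ + (a₂ - a₃) * l₂ + (a₃ - a₄) * l₃ + (a₄ - a₁) * l₄ = 0 := by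
    linear_combination -y1 + y2 - y3 + y4 - y5 + y6 - y7 + y8
  have d1 : p₁ - p₂ = b₁ * (a₁ - a₂) := by linear_combination x1 - x2
  have d2 : p₂ - p₃ = b₂ * (a₂ - a₃) := by linear_combination x3 - x4
  have d3 : p₃ - p₄ = b₃ * (a₃ - a₄) := by linear_combination x5 - x6
  have d4 : p₄ - p₁ = b₄ * (a₄ - a₁) := by linear_combination x7 - x8
  have e3 : (a₁ - a₂) * b₁ ^ 2 + (a₂ - a₃) * b₂ ^ 2 + (a₃ - a₄) * b₃ ^ 2 +
      (a₄ - a₁) * b₄ ^ 2 = 0 := by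
    linear_combination -z1 + z2 - z3 + z4 - z5 + z6 - z7 + z8 - b₁ * d1 - b₂ * d2 - b₃ * d3 -
      b₄ * d4
  have f1 : q₁ - q₂ = l₁ * (a₁ - a₂) := by linear_combination y1 - y2
  have f2 : q₂ - q₃ = l₂ * (a₂ - a₃) := by linear_combination y3 - y4
  have f3 : q₃ - q₄ = l₃ * (a₃ - a₄) := by linear_combination y5 - y6
  have f4 : q₄ - q₁ = l₄ * (a₄ - a₁) := by linear_combination y7 - y8
  have e4 : (a₁ - a₂) * b₁ * l₁ + (a₂ - a₃) * b₂ * l₂ + (a₃ - a₄) * b₃ * l₃ +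
      (a₄ - a₁) * b₄ * l₄ = 0 := by
    linear_combination -w1 + w2 - w3 + w4 - w5 + w6 - w7 + w8 - b₁ * f1 - b₂ * f2 - b₃ * f3 -
      b₄ * f4
  have g2 : l₂ - l₁ - a₂ * (b₂ - b₁) = 0 := by linear_combination x3 - x2
  have g3 : l₃ - l₁ - a₂ * (b₃ - b₁) = (a₃ - a₂) * (b₃ - b₂) := by
    linear_combination x3 - x2 + x5 - x4
  have key : (a₃ - a₄) * (b₃ - b₄) * ((a₃ - a₂) * (b₃ - b₂)) = 0 := by
    rw [← g3]
    linear_combination e4 - b₄ * e2 - l₁ * e1 - a₂ * (e3 - b₁ * e1) + b₄ * a₂ * e1 -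
      (b₂ - b₄) * (a₂ - a₃) * g2
  simp only [mul_eq_zero, sub_eq_zero] at key
  rcases key with (h | h) | h | h
  · exact ha₃₄ h
  · exact hb₃₄ h
  · exact ha₂₃ h.symm
  · exact hb₂₃ h.symm

end Incidence

section Layers

variable {F : Type*} [Field F] {T r k : ℕ}

/-- One half of the adjacency of the layered graph: `v` lies in an even layer and is read as a
point, `w` lies in an odd layer and is read as a line. -/
def LayerInc (c : Fin T × Fin r ↪ F) (v w : Fin T × Fin r × (F × F × F × F) × Fin k) : Prop :=
  Even v.1.val ∧ ¬ Even w.1.val ∧ v.2.2.2 = w.2.2.2 ∧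
    Incident (c (v.1, v.2.1)) v.2.2.1 (c (w.1, w.2.1)) w.2.2.1

/-- `k` disjoint copies of an induced subgraph of `D(5, F)`, arranged in `T` layers. -/
def layeredGraph (c : Fin T × Fin r ↪ F) (k : ℕ) :
    SimpleGraph (Fin T × Fin r × (F × F × F × F) × Fin k) where
  Adj v w := LayerInc c v w ∨ LayerInc c w v
  symm := ⟨fun _ _ h => h.symm⟩
  loopless := ⟨fun _ h => h.elim (fun h => h.2.1 h.1) fun h => h.2.1 h.1⟩

variable {c : Fin T × Fin r ↪ F}

lemma layeredGraph_adj_of_even {v w : Fin T × Fin r × (F × F × F × F) × Fin k}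
    (hv : Even v.1.val) : (layeredGraph c k).Adj v w ↔ LayerInc c v w :=
  ⟨fun h => h.resolve_right fun h' => h'.2.1 hv, Or.inl⟩

lemma layeredGraph_adj_of_odd {v w : Fin T × Fin r × (F × F × F × F) × Fin k}
    (hv : ¬ Even v.1.val) : (layeredGraph c k).Adj v w ↔ LayerInc c w v :=
  ⟨fun h => h.resolve_left fun h' => hv h'.1, Or.inr⟩

lemma LayerInc.points_ne {v v' w : Fin T × Fin r × (F × F × F × F) × Fin k}
    (h : LayerInc c v w) (h' : LayerInc c v' w) (hne : v ≠ v') :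
    c (v.1, v.2.1) ≠ c (v'.1, v'.2.1) := by
  intro he
  have hp := h.2.2.2
  rw [he] at hp
  have h1 := hp.point_unique h'.2.2.2
  have h2 := h.2.2.1.trans h'.2.2.1.symm
  have h3 := c.injective he
  simp only [Prod.mk.injEq] at h3
  exact hne (Prod.ext h3.1 (Prod.ext h3.2 (Prod.ext h1 h2)))

lemma LayerInc.lines_ne {v w w' : Fin T × Fin r × (F × F × F × F) × Fin k}
    (h : LayerInc c v w) (h' : LayerInc c v w') (hne : w ≠ w') :
    c (w.1, w.2.1) ≠ c (w'.1, w'.2.1) := by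
  intro he
  have hp := h.2.2.2
  rw [he] at hp
  have h1 := hp.line_unique h'.2.2.2
  have h2 := h.2.2.1.symm.trans h'.2.2.1
  have h3 := c.injective he
  simp only [Prod.mk.injEq] at h3
  exact hne (Prod.ext h3.1 (Prod.ext h3.2 (Prod.ext h1 h2)))

lemma layeredGraph_octagon {v : Fin 8 → Fin T × Fin r × (F × F × F × F) × Fin k}
    (hinj : Function.Injective v) (hadj : ∀ i, (layeredGraph c k).Adj (v i) (v (i + 1)))
    (h0 : Even (v 0).1.val) : False := by
  have a0 := (layeredGraph_adj_of_even h0).1 (hadj 0)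
  have a1 := (layeredGraph_adj_of_odd a0.2.1).1 (hadj 1)
  have a2 := (layeredGraph_adj_of_even a1.1).1 (hadj 2)
  have a3 := (layeredGraph_adj_of_odd a2.2.1).1 (hadj 3)
  have a4 := (layeredGraph_adj_of_even a3.1).1 (hadj 4)
  have a5 := (layeredGraph_adj_of_odd a4.2.1).1 (hadj 5)
  have a6 := (layeredGraph_adj_of_even a5.1).1 (hadj 6)
  have a7 := (layeredGraph_adj_of_odd a6.2.1).1 (hadj 7)
  exact incident_octagon a0.2.2.2 a1.2.2.2 a2.2.2.2 a3.2.2.2 a4.2.2.2 a5.2.2.2 a6.2.2.2 a7.2.2.2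
    (a2.points_ne a3 (hinj.ne (by decide))) (a4.points_ne a5 (hinj.ne (by decide)))
    (a3.lines_ne a4 (hinj.ne (by decide))) (a5.lines_ne a6 (hinj.ne (by decide)))

theorem layeredGraph_not_containsCopy :
    ¬ ContainsCopy (cycleGraph 8) (layeredGraph c k) := by
  intro h
  obtain ⟨f, hinj, hadj⟩ := exists_closed_walk_of_containsCopy h
  by_cases h0 : Even (f 0).1.val
  · exact layeredGraph_octagon hinj hadj h0
  · have h1 := (layeredGraph_adj_of_odd h0).1 (hadj 0)
    refine layeredGraph_octagon (v := fun i => f (i + 1)) (fun i j h => ?_)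
      (fun i => hadj (i + 1)) h1.1
    exact add_right_cancel (hinj h)

end Layers

section Matchings

open Finset Equiv

variable {Z : Type*} [Fintype Z] [DecidableEq Z]

open Classical in
/-- Pairs of a permutation and a set `K` of `k` points at which it follows the relation `E`. -/
noncomputable def partialMatchings (E : Z → Z → Prop) (k : ℕ) : Finset (Perm Z × Finset Z) :=
  univ.filter fun ω => #ω.2 = k ∧ ∀ a ∈ ω.2, E a (ω.1 a)

open Classical in
/-- Simple alternating paths with `s` steps starting at an unmatched point. -/
noncomputable def altPaths (E : Z → Z → Prop) (ω : Perm Z × Finset Z) (s : ℕ) :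
    Finset (Fin (s + 1) → Z) :=
  univ.filter fun p => Function.Injective p ∧ p 0 ∉ ω.2 ∧
    ∀ i : Fin s, p i.succ ∈ ω.2 ∧ E (p i.castSucc) (ω.1 (p i.succ))

open Classical in
/-- The number of alternating walks with a given number of steps and a given start. -/
noncomputable def walkCount (E : Z → Z → Prop) (ω : Perm Z × Finset Z) : ℕ → Z → ℕ
  | 0, _ => 1
  | s + 1, a => ∑ a' ∈ ω.2 with E a (ω.1 a'), walkCount E ω s a'

open Classical in
/-- Pairs of unmatched points that can be joined by one step. -/
noncomputable def openPairs (E : Z → Z → Prop) (ω : Perm Z × Finset Z) : Finset (Z × Z) :=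
  univ.filter fun x => x.1 ∉ ω.2 ∧ x.2 ∉ ω.2 ∧ E x.1 (ω.1 x.2)

open Classical in
/-- Every point is related to exactly `r` points, on either side. -/
def IsBiregular (E : Z → Z → Prop) (r : ℕ) : Prop :=
  (∀ a, #{b | E a b} = r) ∧ ∀ b, #{a | E a b} = r

variable {E : Z → Z → Prop} {r : ℕ}

omit [DecidableEq Z] in
open Classical in
lemma IsBiregular.card_perm (hE : IsBiregular E r) (σ : Perm Z) (a : Z) :
    #{a' | E a (σ a')} = r := by
  rw [← hE.1 a]
  refine Finset.card_bij (fun a' _ => σ a') ?_ ?_ ?_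
  · intro x hx; simpa using hx
  · intro x _ y _ h; exact σ.injective h
  · intro b hb; exact ⟨σ.symm b, by simpa using hb, by simp⟩

omit [DecidableEq Z] in
lemma walkCount_le (hE : IsBiregular E r) (ω : Perm Z × Finset Z) (s : ℕ) (a : Z) :
    walkCount E ω s a ≤ r ^ s := by
  classical
  induction s generalizing a with
  | zero => simp [walkCount]
  | succ s ih =>
    rw [walkCount]
    refine (Finset.sum_le_card_nsmul _ _ _ fun x _ => ih x).trans ?_
    rw [smul_eq_mul, pow_succ']
    refine Nat.mul_le_mul_right _ ?_
    rw [← hE.card_perm ω.1 a]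
    refine Finset.card_le_card fun x hx => ?_
    simp only [mem_filter, mem_univ, true_and] at hx ⊢
    exact hx.2

omit [DecidableEq Z] in
lemma sum_walkCount_succ (hE : IsBiregular E r) (ω : Perm Z × Finset Z) (s : ℕ) :
    ∑ a, walkCount E ω (s + 1) a = r * ∑ a ∈ ω.2, walkCount E ω s a := by
  classical
  simp only [walkCount, Finset.sum_filter]
  rw [Finset.sum_comm, Finset.mul_sum]
  refine Finset.sum_congr rfl fun a' _ => ?_
  rw [← Finset.sum_filter, Finset.sum_const, hE.2, smul_eq_mul]

open Classical in
lemma card_walks_le (ω : Perm Z × Finset Z) (s : ℕ) (a : Z) :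
    #{p : Fin (s + 1) → Z | p 0 = a ∧
      ∀ i : Fin s, p i.succ ∈ ω.2 ∧ E (p i.castSucc) (ω.1 (p i.succ))} ≤ walkCount E ω s a := by
  induction s generalizing a with
  | zero =>
    rw [walkCount, Finset.card_le_one]
    intro p hp q hq
    simp only [mem_filter, mem_univ, true_and] at hp hq
    funext i
    rw [Fin.fin_one_eq_zero i]
    exact hp.1.trans hq.1.symm
  | succ s ih =>
    rw [walkCount]
    refine (Finset.card_le_card (t := ({a' ∈ ω.2 | E a (ω.1 a')} : Finset Z).biUnion fun a' =>
      ({p : Fin (s + 1) → Z | p 0 = a' ∧ ∀ i : Fin s, p i.succ ∈ ω.2 ∧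
        E (p i.castSucc) (ω.1 (p i.succ))} : Finset _).image fun p => Fin.cons a p) ?_).trans ?_
    · intro p hp
      simp only [mem_filter, mem_univ, true_and] at hp
      simp only [mem_biUnion, mem_image, mem_filter, mem_univ, true_and]
      refine ⟨p 1, ⟨(hp.2 0).1, ?_⟩, Fin.tail p, ⟨rfl, fun i => ?_⟩, ?_⟩
      · have := (hp.2 0).2
        rwa [Fin.castSucc_zero, hp.1] at this
      · exact hp.2 i.succ
      · rw [← hp.1, Fin.cons_self_tail]
    · refine Finset.card_biUnion_le.trans (Finset.sum_le_sum fun a' _ => ?_)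
      exact Finset.card_image_le.trans (ih a')

open Classical in
lemma card_altPaths_start_le (ω : Perm Z × Finset Z) (s : ℕ) (a : Z) :
    #{p ∈ altPaths E ω s | p 0 = a} ≤ walkCount E ω s a := by
  refine (Finset.card_le_card fun p hp => ?_).trans (card_walks_le ω s a)
  simp only [altPaths, mem_filter, mem_univ, true_and] at hp ⊢
  exact ⟨hp.2, hp.1.2.2⟩

lemma sum_altPaths_le (ω : Perm Z × Finset Z) (s : ℕ) (f : Z → ℕ) :
    ∑ p ∈ altPaths E ω s, f (p 0) ≤ ∑ a ∈ ω.2ᶜ, walkCount E ω s a * f a := by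
  classical
  rw [← Finset.sum_fiberwise_of_maps_to (t := ω.2ᶜ) (g := fun p => p 0)]
  · refine Finset.sum_le_sum fun a _ => ?_
    rw [Finset.sum_congr rfl (g := fun _ => f a), Finset.sum_const, smul_eq_mul]
    · exact Nat.mul_le_mul_right _ (card_altPaths_start_le ω s a)
    · intro p hp
      rw [(mem_filter.1 hp).2]
  · intro p hp
    simp only [altPaths, mem_filter, mem_univ, true_and] at hp
    simpa using hp.2.1

lemma card_altPaths_le (ω : Perm Z × Finset Z) (s : ℕ) :
    #(altPaths E ω s) ≤ ∑ a ∈ ω.2ᶜ, walkCount E ω s a := by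
  simpa using sum_altPaths_le (E := E) ω s fun _ => 1

lemma card_altPaths_zero (ω : Perm Z × Finset Z) : #(altPaths E ω 0) = #ω.2ᶜ := by
  classical
  refine Finset.card_bij (fun p _ => p 0) ?_ ?_ ?_
  · intro p hp
    simp only [altPaths, mem_filter, mem_univ, true_and] at hp
    simpa using hp.2.1
  · intro p _ q _ h
    funext i
    rw [Fin.fin_one_eq_zero i]
    exact h
  · intro a ha
    refine ⟨fun _ => a, ?_, rfl⟩
    simp only [altPaths, mem_filter, mem_univ, true_and]
    exact ⟨fun i j _ => (Fin.fin_one_eq_zero i).trans (Fin.fin_one_eq_zero j).symm,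
      by simpa using ha, fun i => i.elim0⟩

/-- Total number of alternating paths with `s` steps over all partial matchings of size `k`. -/
noncomputable def pathTotal (E : Z → Z → Prop) (k s : ℕ) : ℕ :=
  ∑ ω ∈ partialMatchings E k, #(altPaths E ω s)

/-- Total number of open pairs over all partial matchings of size `k`. -/
noncomputable def openTotal (E : Z → Z → Prop) (k : ℕ) : ℕ :=
  ∑ ω ∈ partialMatchings E k, #(openPairs E ω)

lemma mem_partialMatchings {k : ℕ} {ω : Perm Z × Finset Z} :
    ω ∈ partialMatchings E k ↔ #ω.2 = k ∧ ∀ a ∈ ω.2, E a (ω.1 a) := by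
  simp [partialMatchings]

lemma mem_altPaths {ω : Perm Z × Finset Z} {s : ℕ} {p : Fin (s + 1) → Z} :
    p ∈ altPaths E ω s ↔ Function.Injective p ∧ p 0 ∉ ω.2 ∧
      ∀ i : Fin s, p i.succ ∈ ω.2 ∧ E (p i.castSucc) (ω.1 (p i.succ)) := by
  simp [altPaths]

lemma card_openPairs (ω : Perm Z × Finset Z) [DecidableRel E] :
    #(openPairs E ω) = ∑ a ∈ ω.2ᶜ, #{a' ∈ ω.2ᶜ | E a (ω.1 a')} := by
  classical
  rw [← Finset.card_sigma]
  refine Finset.card_bij (fun x _ => ⟨x.1, x.2⟩) ?_ ?_ ?_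
  · intro x hx
    simp only [openPairs, mem_filter, mem_univ, true_and] at hx
    simpa using ⟨hx.1, hx.2.1, hx.2.2⟩
  · rintro ⟨x, y⟩ _ ⟨x', y'⟩ _ h
    simpa using h
  · rintro ⟨x, y⟩ h
    refine ⟨(x, y), ?_, rfl⟩
    simpa [openPairs] using h

lemma openTotal_le (k : ℕ) :
    openTotal E k ≤ #(partialMatchings E (k + 1)) * (Fintype.card Z * Fintype.card Z) := by
  classical
  rw [openTotal, ← Finset.card_sigma, ← Fintype.card_prod, ← Finset.card_univ (α := Z × Z),
    ← Finset.card_product]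
  refine Finset.card_le_card_of_injOn
    (fun x => ((x.1.1 * swap x.2.1 x.2.2, insert x.2.1 x.1.2), x.2)) ?_ ?_
  · rintro ⟨⟨σ, K⟩, a, a'⟩ hx
    simp only [coe_sigma, Set.mem_sigma_iff, mem_coe, mem_partialMatchings, openPairs, mem_filter,
      mem_univ, true_and] at hx
    obtain ⟨⟨hc, hK⟩, ha, ha', hE⟩ := hx
    simp only [mem_coe, mem_product, mem_univ, and_true, mem_partialMatchings]
    refine ⟨by rw [card_insert_of_notMem ha, hc], fun x hx => ?_⟩
    rcases Finset.mem_insert.1 hx with rfl | hx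
    · simpa using hE
    · have h1 : x ≠ a := fun h => ha (h ▸ hx)
      have h2 : x ≠ a' := fun h => ha' (h ▸ hx)
      simpa [swap_apply_of_ne_of_ne h1 h2] using hK x hx
  · rintro ⟨⟨σ, K⟩, a, a'⟩ hx ⟨⟨σ', K'⟩, b, b'⟩ hy h
    simp only [coe_sigma, Set.mem_sigma_iff, mem_coe, mem_partialMatchings, openPairs, mem_filter,
      mem_univ, true_and] at hx hy
    simp only [Prod.mk.injEq] at h
    obtain ⟨⟨h1, h2⟩, rfl, rfl⟩ := h
    have h3 : σ = σ' := mul_right_cancel h1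
    have h4 : K = K' := by
      rw [← erase_insert hx.2.1, h2, erase_insert hy.2.1]
    subst h3 h4
    rfl

open Classical in
lemma sum_rotate_le (k s : ℕ) :
    ∑ ω ∈ partialMatchings E k, ∑ p ∈ altPaths E ω s,
      #{a' ∈ ω.2 | E (p 0) (ω.1 a') ∧ ∀ i, p i ≠ a'} ≤ pathTotal E k (s + 1) := by
  rw [pathTotal, ← Finset.card_sigma]
  simp_rw [← Finset.card_sigma]
  refine Finset.card_le_card_of_injOn
    (fun x => ⟨(x.1.1 * swap (x.2.1 0) x.2.2, insert (x.2.1 0) (x.1.2.erase x.2.2)),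
      Fin.cons x.2.2 x.2.1⟩) ?_ ?_
  · rintro ⟨⟨σ, K⟩, p, a'⟩ hx
    simp only [coe_sigma, Set.mem_sigma_iff, mem_coe, mem_partialMatchings, mem_altPaths,
      mem_filter] at hx
    obtain ⟨⟨hc, hK⟩, ⟨hp, hp0, hpE⟩, ha', hE, hne⟩ := hx
    simp only [coe_sigma, Set.mem_sigma_iff, mem_coe, mem_partialMatchings, mem_altPaths]
    refine ⟨⟨?_, ?_⟩, ?_, ?_, ?_⟩
    · rw [card_insert_of_notMem (fun h => hp0 (mem_of_mem_erase h)), card_erase_of_mem ha', hc]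
      have : 0 < k := hc ▸ card_pos.2 ⟨a', ha'⟩
      omega
    · intro x hx
      rcases Finset.mem_insert.1 hx with rfl | hx
      · simpa using hE
      · obtain ⟨h2, hxK⟩ := Finset.mem_erase.1 hx
        have h1 : x ≠ p 0 := fun h => hp0 (h ▸ hxK)
        simpa [swap_apply_of_ne_of_ne h1 h2] using hK x hxK
    · rw [Fin.cons_injective_iff]
      exact ⟨by rintro ⟨i, hi⟩; exact hne i hi, hp⟩
    · simp [(hne 0).symm]
    · intro i
      refine Fin.cases ?_ (fun j => ?_) i
      · simpa using hK a' ha'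
      · have h1 : p j.succ ≠ p 0 := fun h => (Fin.succ_ne_zero j) (hp h)
        have h2 := hne j.succ
        simp only [Fin.cons_succ, Fin.castSucc_succ, Perm.coe_mul, Function.comp_apply,
          swap_apply_of_ne_of_ne h1 h2, mem_insert, mem_erase]
        exact ⟨Or.inr ⟨h2, (hpE j).1⟩, (hpE j).2⟩
  · rintro ⟨⟨σ, K⟩, p, a⟩ hx ⟨⟨σ', K'⟩, p', a'⟩ hy h
    simp only [coe_sigma, Set.mem_sigma_iff, mem_coe, mem_partialMatchings, mem_altPaths,
      mem_filter] at hx hy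
    simp only [Sigma.mk.injEq, Prod.mk.injEq, heq_eq_eq] at h
    obtain ⟨⟨h1, h2⟩, h3⟩ := h
    obtain ⟨rfl, rfl⟩ := Fin.cons_inj.1 h3
    have h4 : σ = σ' := mul_right_cancel h1
    have h5 : K = K' := by
      have e1 : p 0 ∉ K.erase a := fun h => hx.2.1.2.1 (mem_of_mem_erase h)
      have e2 : p 0 ∉ K'.erase a := fun h => hy.2.1.2.1 (mem_of_mem_erase h)
      rw [← insert_erase hx.2.2.1, ← insert_erase hy.2.2.1, ← erase_insert e1, h2,
        erase_insert e2]
    subst h4 h5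
    rfl

lemma mul_pathTotal_le (hE : IsBiregular E r) (k s : ℕ) :
    r * pathTotal E k s ≤ pathTotal E k (s + 1) + s * pathTotal E k s + r ^ s * openTotal E k := by
  classical
  have key : ∀ ω ∈ partialMatchings E k, ∀ p ∈ altPaths E ω s,
      r ≤ #{a' ∈ ω.2 | E (p 0) (ω.1 a') ∧ ∀ i, p i ≠ a'} + s +
        #{a' ∈ ω.2ᶜ | E (p 0) (ω.1 a')} := by
    intro ω _ p hp
    rw [mem_altPaths] at hp
    rw [← hE.card_perm ω.1 (p 0)]
    have : #((univ : Finset (Fin s)).image fun i => p i.succ) ≤ s :=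
      Finset.card_image_le.trans (by simp)
    refine (Finset.card_le_card (t := ({a' ∈ ω.2 | E (p 0) (ω.1 a') ∧ ∀ i, p i ≠ a'} ∪
      (univ : Finset (Fin s)).image fun i => p i.succ) ∪ {a' ∈ ω.2ᶜ | E (p 0) (ω.1 a')}) ?_).trans ?_
    · intro x hx
      simp only [mem_filter, mem_univ, true_and] at hx
      simp only [mem_union, mem_filter, mem_image, mem_univ, true_and, mem_compl]
      by_cases hxK : x ∈ ω.2
      · by_cases h : ∃ i, p i = x
        · obtain ⟨i, rfl⟩ := h
          refine Or.inl (Or.inr ?_)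
          rcases Fin.eq_zero_or_eq_succ i with rfl | ⟨j, rfl⟩
          · exact absurd hxK hp.2.1
          · exact ⟨j, rfl⟩
        · push Not at h
          exact Or.inl (Or.inl ⟨hxK, hx, h⟩)
      · exact Or.inr ⟨hxK, hx⟩
    · refine (Finset.card_union_le _ _).trans (Nat.add_le_add_right ?_ _)
      exact (Finset.card_union_le _ _).trans (Nat.add_le_add_left this _)
  calc r * pathTotal E k s = ∑ ω ∈ partialMatchings E k, ∑ p ∈ altPaths E ω s, r := by
        simp only [pathTotal, Finset.mul_sum, Finset.sum_const, smul_eq_mul, mul_comm]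
    _ ≤ ∑ ω ∈ partialMatchings E k, ∑ p ∈ altPaths E ω s,
        (#{a' ∈ ω.2 | E (p 0) (ω.1 a') ∧ ∀ i, p i ≠ a'} + s + #{a' ∈ ω.2ᶜ | E (p 0) (ω.1 a')}) :=
        Finset.sum_le_sum fun ω hω => Finset.sum_le_sum fun p hp => key ω hω p hp
    _ = ∑ ω ∈ partialMatchings E k, ∑ p ∈ altPaths E ω s,
          #{a' ∈ ω.2 | E (p 0) (ω.1 a') ∧ ∀ i, p i ≠ a'} + s * pathTotal E k s +
        ∑ ω ∈ partialMatchings E k, ∑ p ∈ altPaths E ω s, #{a' ∈ ω.2ᶜ | E (p 0) (ω.1 a')} := by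
        simp only [Finset.sum_add_distrib, pathTotal, Finset.mul_sum, Finset.sum_const, smul_eq_mul,
          mul_comm]
    _ ≤ _ := by
        refine Nat.add_le_add (Nat.add_le_add_right (sum_rotate_le k s) _) ?_
        rw [openTotal, Finset.mul_sum]
        refine Finset.sum_le_sum fun ω _ => ?_
        refine (sum_altPaths_le ω s fun a => #{a' ∈ ω.2ᶜ | E a (ω.1 a')}).trans ?_
        rw [card_openPairs, Finset.mul_sum]
        exact Finset.sum_le_sum fun a _ => Nat.mul_le_mul_right _ (walkCount_le hE ω s a)

lemma pathTotal_zero (k : ℕ) :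
    pathTotal E k 0 = #(partialMatchings E k) * (Fintype.card Z - k) := by
  rw [pathTotal, Finset.sum_congr rfl (g := fun _ => Fintype.card Z - k), Finset.sum_const,
    smul_eq_mul]
  intro ω hω
  rw [card_altPaths_zero, card_compl, (mem_partialMatchings.1 hω).1]

lemma pathTotal_le (hE : IsBiregular E r) (k s : ℕ) :
    pathTotal E k s ≤ r ^ s * pathTotal E k 0 := by
  rw [pathTotal, pathTotal, Finset.mul_sum]
  refine Finset.sum_le_sum fun ω _ => (card_altPaths_le ω s).trans ?_
  rw [card_altPaths_zero, mul_comm, ← smul_eq_mul]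
  exact Finset.sum_le_card_nsmul _ _ _ fun a _ => walkCount_le hE ω s a

lemma sum_pathTotal_le (hE : IsBiregular E r) (hr : 0 < r) (k S : ℕ) :
    ∑ s ∈ range S, (pathTotal E k s : ℝ) / r ^ s ≤
      #(partialMatchings E k) * Fintype.card Z := by
  have hr' : (0 : ℝ) < r := by exact_mod_cast hr
  have key : ∀ ω : Perm Z × Finset Z, ∑ s ∈ range S, (#(altPaths E ω s) : ℝ) / r ^ s ≤
      Fintype.card Z := by
    intro ω
    set W : ℕ → ℝ := fun s => ((∑ a, walkCount E ω s a : ℕ) : ℝ) / r ^ s with hW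
    have h1 : ∀ s, (#(altPaths E ω s) : ℝ) / r ^ s ≤ W s - W (s + 1) := by
      intro s
      have e1 : ((∑ a, walkCount E ω (s + 1) a : ℕ) : ℝ) =
          r * (∑ a ∈ ω.2, walkCount E ω s a : ℕ) := by
        rw [sum_walkCount_succ hE]; push_cast; rfl
      have e2 : ((∑ a, walkCount E ω s a : ℕ) : ℝ) = (∑ a ∈ ω.2, walkCount E ω s a : ℕ) +
          (∑ a ∈ ω.2ᶜ, walkCount E ω s a : ℕ) := by
        rw [← Finset.sum_add_sum_compl ω.2]; push_cast; rfl
      have e3 : (#(altPaths E ω s) : ℝ) ≤ (∑ a ∈ ω.2ᶜ, walkCount E ω s a : ℕ) := by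
        exact_mod_cast card_altPaths_le ω s
      have e4 : W s - W (s + 1) = (∑ a ∈ ω.2ᶜ, walkCount E ω s a : ℕ) / r ^ s := by
        simp only [hW]
        rw [e1, e2, pow_succ]
        field_simp
        ring
      rw [e4]
      gcongr
    calc _ ≤ ∑ s ∈ range S, (W s - W (s + 1)) := Finset.sum_le_sum fun s _ => h1 s
      _ = W 0 - W S := Finset.sum_range_sub' _ _
      _ ≤ W 0 := sub_le_self _ (by positivity)
      _ = Fintype.card Z := by simp [hW, walkCount]
  calc _ = ∑ ω ∈ partialMatchings E k, ∑ s ∈ range S, (#(altPaths E ω s) : ℝ) / r ^ s := by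
        rw [Finset.sum_comm]
        refine Finset.sum_congr rfl fun s _ => ?_
        rw [pathTotal, Nat.cast_sum, Finset.sum_div]
    _ ≤ _ := by
        rw [← nsmul_eq_mul]
        exact Finset.sum_le_card_nsmul _ _ _ fun ω _ => key ω

lemma le_openTotal (hE : IsBiregular E r) {k S : ℕ} (hr : 2 * S ^ 2 ≤ r) (hS : 0 < S)
    (hk : 4 * Fintype.card Z ≤ S * (Fintype.card Z - k)) :
    (r : ℝ) * pathTotal E k 0 ≤ 4 * S * openTotal E k := by
  have hr0 : 0 < r := lt_of_lt_of_le (by positivity) hr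
  have hr' : (0 : ℝ) < r := by exact_mod_cast hr0
  have hS' : (0 : ℝ) < S := by exact_mod_cast hS
  have hrS : 2 * (S : ℝ) ^ 2 ≤ r := by exact_mod_cast hr
  set N : ℕ → ℝ := fun s => (pathTotal E k s : ℝ) / r ^ s with hN
  set e : ℝ := (openTotal E k : ℝ)
  have hN0 : N 0 = pathTotal E k 0 := by simp [hN]
  have hNle : ∀ s, N s ≤ N 0 := by
    intro s
    rw [hN0]
    simp only [hN]
    rw [div_le_iff₀ (by positivity), mul_comm]
    exact_mod_cast pathTotal_le hE k s
  have hstep : ∀ s ≤ S, N s - S / r * N 0 - e / r ≤ N (s + 1) := by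
    intro s hs
    have h1 : (r : ℝ) * pathTotal E k s ≤
        pathTotal E k (s + 1) + s * pathTotal E k s + r ^ s * (openTotal E k : ℝ) := by
      exact_mod_cast mul_pathTotal_le hE k s
    have h2 : N s ≤ N (s + 1) + s / r * N s + e / r := by
      have h3 : r ^ (s + 1) * N s ≤ r ^ (s + 1) * (N (s + 1) + s / r * N s + e / r) := by
        calc _ = (r : ℝ) * pathTotal E k s := by simp only [hN]; field_simp; ring
          _ ≤ _ := h1
          _ = _ := by simp only [hN]; field_simp; ring
      exact le_of_mul_le_mul_left h3 (by positivity)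
    have h4 : (s : ℝ) / r * N s ≤ S / r * N 0 := by
      have : (s : ℝ) ≤ S := by exact_mod_cast hs
      have : 0 ≤ N s := by positivity
      gcongr
      exact hNle s
    linarith
  have hlow : ∀ s ≤ S, N 0 - s * (S / r * N 0 + e / r) ≤ N s := by
    intro s
    induction s with
    | zero => simp
    | succ s ih =>
      intro hs
      have := hstep s (by omega)
      have := ih (by omega)
      push_cast
      linarith
  have hsum := sum_pathTotal_le hE hr0 k S
  have hpos : 0 ≤ S / r * N 0 + e / r := by positivity
  have hlow2 : S * (N 0 - S * (S / r * N 0 + e / r)) ≤ ∑ s ∈ range S, N s := by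
    calc _ = ∑ s ∈ range S, (N 0 - S * (S / r * N 0 + e / r)) := by simp [mul_sub]
      _ ≤ _ := by
        refine Finset.sum_le_sum fun s hs => le_trans ?_ (hlow s (mem_range.1 hs).le)
        have : (s : ℝ) ≤ S := by exact_mod_cast (mem_range.1 hs).le
        gcongr
  have hmain : (4 : ℝ) * (#(partialMatchings E k) * Fintype.card Z) ≤ S * N 0 := by
    rw [hN0, pathTotal_zero]
    have : 4 * (#(partialMatchings E k) * Fintype.card Z) ≤
      S * (#(partialMatchings E k) * (Fintype.card Z - k)) := by
      calc _ = #(partialMatchings E k) * (4 * Fintype.card Z) := by ring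
        _ ≤ #(partialMatchings E k) * (S * (Fintype.card Z - k)) := Nat.mul_le_mul_left _ hk
        _ = _ := by ring
    exact_mod_cast this
  have h5 : 4 * (S * (N 0 - S * (S / r * N 0 + e / r))) ≤ S * N 0 := by linarith
  have h6 : 4 * (N 0 - S * (S / r * N 0 + e / r)) ≤ N 0 := by
    have : S * (4 * (N 0 - S * (S / r * N 0 + e / r))) ≤ S * N 0 := by linarith
    exact le_of_mul_le_mul_left this hS'
  have h7 : (S : ℝ) * (S / r * N 0) ≤ N 0 / 2 := by
    have : (S : ℝ) * S / r ≤ 1 / 2 := by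
      rw [div_le_div_iff₀ hr' (by norm_num)]
      nlinarith
    calc (S : ℝ) * (S / r * N 0) = (S * S / r) * N 0 := by ring
      _ ≤ 1 / 2 * N 0 := by gcongr
      _ = _ := by ring
  have h8 : N 0 ≤ 4 * (S * (e / r)) := by nlinarith
  rw [← hN0]
  calc (r : ℝ) * N 0 ≤ r * (4 * (S * (e / r))) := by gcongr
    _ = _ := by field_simp

lemma card_partialMatchings_zero : #(partialMatchings E 0) = (Fintype.card Z).factorial := by
  classical
  rw [← Fintype.card_perm, ← Finset.card_univ]
  refine Finset.card_bij (fun ω _ => ω.1) (fun _ _ => mem_univ _) ?_ ?_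
  · rintro ⟨σ, K⟩ h ⟨σ', K'⟩ h' e
    have h1 := Finset.card_eq_zero.1 (mem_partialMatchings.1 h).1
    have h2 := Finset.card_eq_zero.1 (mem_partialMatchings.1 h').1
    simp only at h1 h2 e
    rw [h1, h2, e]
  · intro σ _
    exact ⟨(σ, ∅), by simp [mem_partialMatchings], rfl⟩

lemma card_partialMatchings_succ (hE : IsBiregular E r) {k S : ℕ} (hr : 2 * S ^ 2 ≤ r)
    (hS : 0 < S) (hZ : 0 < Fintype.card Z) (hk : 4 * Fintype.card Z ≤ S * (Fintype.card Z - k)) :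
    r * #(partialMatchings E k) ≤ S ^ 2 * Fintype.card Z * #(partialMatchings E (k + 1)) := by
  have h1 : r * pathTotal E k 0 ≤ 4 * S * openTotal E k := by
    exact_mod_cast le_openTotal hE hr hS hk
  have h2 := openTotal_le (E := E) k
  rw [pathTotal_zero] at h1
  have h3 : (4 * Fintype.card Z) * (r * #(partialMatchings E k)) ≤ (4 * Fintype.card Z) *
      (S ^ 2 * Fintype.card Z * #(partialMatchings E (k + 1))) := by
    calc _ ≤ (S * (Fintype.card Z - k)) * (r * #(partialMatchings E k)) :=
          Nat.mul_le_mul_right _ hk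
      _ = S * (r * (#(partialMatchings E k) * (Fintype.card Z - k))) := by ring
      _ ≤ S * (4 * S * openTotal E k) := Nat.mul_le_mul_left _ h1
      _ ≤ S * (4 * S * (#(partialMatchings E (k + 1)) * (Fintype.card Z * Fintype.card Z))) := by
          gcongr
      _ = _ := by ring
  exact Nat.le_of_mul_le_mul_left h3 (by positivity)

lemma factorial_mul_pow_le (hE : IsBiregular E r) {k S : ℕ} (hr : 2 * S ^ 2 ≤ r)
    (hS : 0 < S) (hZ : 0 < Fintype.card Z) (hk : 4 * Fintype.card Z ≤ S * (Fintype.card Z - k)) :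
    (Fintype.card Z).factorial * r ^ k ≤
      (S ^ 2 * Fintype.card Z) ^ k * #(partialMatchings E k) := by
  induction k with
  | zero => simp [card_partialMatchings_zero]
  | succ k ih =>
    have hk' : 4 * Fintype.card Z ≤ S * (Fintype.card Z - k) :=
      hk.trans (Nat.mul_le_mul_left _ (by omega))
    calc (Fintype.card Z).factorial * r ^ (k + 1)
        = r * ((Fintype.card Z).factorial * r ^ k) := by ring
      _ ≤ r * ((S ^ 2 * Fintype.card Z) ^ k * #(partialMatchings E k)) :=
          Nat.mul_le_mul_left _ (ih hk')
      _ = (S ^ 2 * Fintype.card Z) ^ k * (r * #(partialMatchings E k)) := by ring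
      _ ≤ (S ^ 2 * Fintype.card Z) ^ k *
          (S ^ 2 * Fintype.card Z * #(partialMatchings E (k + 1))) :=
          Nat.mul_le_mul_left _ (card_partialMatchings_succ hE hr hS hZ hk')
      _ = _ := by ring

end Matchings

section Pigeonhole

open Finset

lemma exists_card_le_mul_card_fiber {α β : Type*} [Fintype β] [DecidableEq β] [Nonempty β]
    (s : Finset α) (f : α → β) : ∃ b, #s ≤ Fintype.card β * #{x ∈ s | f x = b} := by
  obtain ⟨b, -, hb⟩ := Finset.exists_max_image univ (fun b => #{x ∈ s | f x = b}) univ_nonempty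
  refine ⟨b, ?_⟩
  rw [Finset.card_eq_sum_card_fiberwise (f := f) (t := univ) (by simp), ← smul_eq_mul,
    ← Finset.card_univ]
  exact Finset.sum_le_card_nsmul _ _ _ fun x hx => hb x hx

lemma pow_self_le_three_pow_mul_factorial (m : ℕ) : m ^ m ≤ 3 ^ m * m.factorial := by
  have h1 := Real.pow_div_factorial_le_exp (m : ℝ) (by positivity) m
  rw [div_le_iff₀ (by positivity)] at h1
  have h2 : Real.exp m ≤ 3 ^ m := by
    rw [← mul_one (m : ℝ), Real.exp_nat_mul]
    exact pow_le_pow_left₀ (by positivity) Real.exp_one_lt_three.le _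
  have h3 : (m : ℝ) ^ m ≤ 3 ^ m * m.factorial := h1.trans (by gcongr)
  exact_mod_cast h3

end Pigeonhole

section ManyMatchings

open Finset Equiv

open Classical in
/-- A biregular relation is followed, at a fixed large set of points, by many permutations that
agree elsewhere. -/
theorem exists_many_perms {Z : Type*} [Fintype Z] [Nonempty Z] {E : Z → Z → Prop} {r : ℕ}
    (hE : IsBiregular E r) {k S : ℕ} (hr : 2 * S ^ 2 ≤ r) (hS : 0 < S)
    (hk : 4 * Fintype.card Z ≤ S * (Fintype.card Z - k)) :
    ∃ (K : Finset Z) (e : Z → Z), #K = k ∧ r ^ k ≤ (6 * S ^ 2) ^ Fintype.card Z *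
      #{σ : Perm Z | (∀ a ∈ K, E a (σ a)) ∧ ∀ a ∉ K, σ a = e a} := by
  set m := Fintype.card Z with hm
  have hZ : 0 < m := Fintype.card_pos
  have hkm : k ≤ m := by
    by_contra h
    rw [Nat.sub_eq_zero_of_le (by omega)] at hk
    omega
  obtain ⟨K, hK⟩ := exists_card_le_mul_card_fiber (partialMatchings E k) Prod.snd
  set A := ({x ∈ partialMatchings E k | x.2 = K} : Finset (Perm Z × Finset Z))
  obtain ⟨g, hg⟩ := exists_card_le_mul_card_fiber A fun x (a : {a // a ∉ K}) => x.1 a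
  have hfac := factorial_mul_pow_le hE hr hS hZ hk
  have hpos : 0 < #(partialMatchings E k) := by
    have : 0 < m.factorial * r ^ k := by
      have : 0 < r := lt_of_lt_of_le (by positivity) hr
      positivity
    exact Nat.pos_of_mul_pos_left (this.trans_le hfac)
  have hA : 0 < #A := Nat.pos_of_mul_pos_left (hpos.trans_le hK)
  have hKk : #K = k := by
    obtain ⟨x, hx⟩ := Finset.card_pos.1 hA
    obtain ⟨h1, h2⟩ := mem_filter.1 hx
    rw [← h2]
    exact (mem_partialMatchings.1 h1).1
  refine ⟨K, fun a => if h : a ∈ K then a else g ⟨a, h⟩, hKk, ?_⟩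
  set B : Finset (Perm Z) := {σ : Perm Z | (∀ a ∈ K, E a (σ a)) ∧ ∀ a ∉ K,
    σ a = if h : a ∈ K then a else g ⟨a, h⟩}
  have hAB : #{x ∈ A | (fun a : {a // a ∉ K} => x.1 a) = g} ≤ #B := by
    refine Finset.card_le_card_of_injOn Prod.fst ?_ ?_
    · intro x hx
      simp only [A, coe_filter, mem_filter, Set.mem_ofPred_eq] at hx
      obtain ⟨⟨h1, h2⟩, h3⟩ := hx
      simp only [B, coe_filter, mem_univ, true_and, Set.mem_ofPred_eq]
      refine ⟨h2 ▸ (mem_partialMatchings.1 h1).2, fun a ha => ?_⟩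
      rw [dif_neg ha, ← h3]
    · intro x hx y hy h
      simp only [A, coe_filter, mem_filter, Set.mem_ofPred_eq] at hx hy
      exact Prod.ext h (hx.1.2.trans hy.1.2.symm)
  have c1 : Fintype.card (Finset Z) = 2 ^ m := by simp [hm]
  have c2 : Fintype.card ({a // a ∉ K} → Z) = m ^ (m - k) := by
    rw [Fintype.card_fun, Fintype.card_subtype_compl, ← hm, Fintype.card_coe, hKk]
  rw [c1] at hK
  rw [c2] at hg
  have h1 : m.factorial * r ^ k ≤ m.factorial * ((6 * S ^ 2) ^ m * #B) := by
    calc m.factorial * r ^ k ≤ (S ^ 2 * m) ^ k * (2 ^ m * (m ^ (m - k) * #B)) := by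
          refine hfac.trans (Nat.mul_le_mul_left _ (hK.trans (Nat.mul_le_mul_left _ ?_)))
          exact hg.trans (Nat.mul_le_mul_left _ hAB)
      _ = (S ^ 2) ^ k * 2 ^ m * #B * (m ^ k * m ^ (m - k)) := by ring
      _ = (S ^ 2) ^ k * 2 ^ m * #B * m ^ m := by rw [← pow_add, Nat.add_sub_cancel' hkm]
      _ ≤ (S ^ 2) ^ m * 2 ^ m * #B * (3 ^ m * m.factorial) := by
          gcongr
          · exact Nat.one_le_pow _ _ hS
          · exact pow_self_le_three_pow_mul_factorial m
      _ = m.factorial * ((S ^ 2) ^ m * (2 ^ m * 3 ^ m) * #B) := by ring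
      _ = _ := by rw [← mul_pow, ← mul_pow]; ring_nf
  exact Nat.le_of_mul_le_mul_left h1 (Nat.factorial_pos _)

end ManyMatchings

section LayerRegularity

open Finset

variable {F : Type*} [Field F] [Fintype F] {T r k : ℕ} {c : Fin T × Fin r ↪ F}

open Classical in
lemma card_filter_eq_of_graph {α β γ : Type*} [Fintype α] [Fintype β] [Fintype γ]
    {p : α × β × γ → Prop} (g : α → β) (t : γ) (hp : ∀ x, p x ↔ x.2.2 = t ∧ x.2.1 = g x.1) :
    #{x | p x} = Fintype.card α := by
  rw [← Finset.card_univ]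
  symm
  refine Finset.card_bij (fun a _ => (a, g a, t)) ?_ ?_ ?_
  · intro a _
    simp [hp]
  · intro a _ b _ h
    exact (Prod.mk.inj h).1
  · rintro ⟨a, b, t'⟩ h
    obtain ⟨h1, h2⟩ := (hp _).1 (mem_filter.1 h).2
    exact ⟨a, mem_univ _, by rw [← h1, ← h2]⟩

lemma isBiregular_layerInc {i j : Fin T} (hi : Even i.val) (hj : ¬ Even j.val) :
    IsBiregular (fun z z' : Fin r × (F × F × F × F) × Fin k => LayerInc c (i, z) (j, z')) r := by
  classical
  constructor
  · intro z
    choose g hg using fun x => exists_incident_line_iff (c (i, z.1)) z.2.1 (c (j, x))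
    rw [card_filter_eq_of_graph g z.2.2, Fintype.card_fin]
    intro z'
    simp [LayerInc, hi, hj, hg, eq_comm]
  · intro z'
    choose g hg using fun x => exists_incident_point_iff (c (i, x)) (c (j, z'.1)) z'.2.1
    rw [card_filter_eq_of_graph g z'.2.2, Fintype.card_fin]
    intro z
    simp [LayerInc, hi, hj, hg]

lemma isBiregular_layeredGraph {c : Fin (T + 1) × Fin r ↪ F} (i : Fin T) :
    IsBiregular (fun z z' : Fin r × (F × F × F × F) × Fin k =>
      (layeredGraph c k).Adj (i.castSucc, z) (i.succ, z')) r := by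
  by_cases hi : Even i.val
  · have h : ∀ z z' : Fin r × (F × F × F × F) × Fin k,
        (layeredGraph c k).Adj (i.castSucc, z) (i.succ, z') ↔
          LayerInc c (i.castSucc, z) (i.succ, z') := fun z z' => layeredGraph_adj_of_even hi
    simp only [h]
    exact isBiregular_layerInc hi (by simpa [Nat.even_add_one] using hi)
  · have h : ∀ z z' : Fin r × (F × F × F × F) × Fin k,
        (layeredGraph c k).Adj (i.castSucc, z) (i.succ, z') ↔
          LayerInc c (i.succ, z') (i.castSucc, z) := fun z z' => layeredGraph_adj_of_odd hi
    simp only [h]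
    have := isBiregular_layerInc (k := k) (c := c) (i := i.succ) (j := i.castSucc)
      (by simpa [Nat.even_add_one] using hi) hi
    exact ⟨this.2, this.1⟩

end LayerRegularity

section CliqueCoclique

open Finset

variable {V : Type*}

/-- The list `l` is the vertex sequence of a Hamilton path of `G`. -/
def IsHamiltonList (G : SimpleGraph V) (l : List V) : Prop :=
  l.Nodup ∧ (∀ v, v ∈ l) ∧ l.IsChain G.Adj

lemma rel_of_toSubgraph_adj {G : SimpleGraph V} {R : V → V → Prop} (hR : ∀ a b, R a b → R b a)
    {u v : V} (p : G.Walk u v) (hp : p.support.IsChain R) {a b : V} (h : p.toSubgraph.Adj a b) :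
    R a b := by
  induction p with
  | nil => simp at h
  | cons hadj q ih =>
    rw [Walk.support_cons, ← Walk.cons_tail_support q, List.isChain_cons_cons,
      Walk.cons_tail_support] at hp
    rw [Walk.toSubgraph, Subgraph.sup_adj] at h
    rcases h with h | h
    · rw [subgraphOfAdj_adj, Sym2.eq_iff] at h
      rcases h with ⟨rfl, rfl⟩ | ⟨rfl, rfl⟩
      · exact hp.1
      · exact hR _ _ hp.1
    · exact ih hp.2 h

lemma exists_equiv_map_eq {α β : Type*} [Fintype α] [Fintype β] [DecidableEq α] [DecidableEq β]
    (h : Fintype.card α = Fintype.card β) {l : List α} {l' : List β} (hl : l.Nodup)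
    (hl' : l'.Nodup) (hm : ∀ a, a ∈ l) (hm' : ∀ b, b ∈ l') : ∃ φ : α ≃ β, l.map φ = l' := by
  have e1 : l.length = Fintype.card α := by
    simpa using Fintype.card_congr (hl.getEquivOfForallMemList l hm)
  have e2 : l'.length = Fintype.card β := by
    simpa using Fintype.card_congr (hl'.getEquivOfForallMemList l' hm')
  refine ⟨(hl.getEquivOfForallMemList l hm).symm.trans ((finCongr (by omega)).trans
    (hl'.getEquivOfForallMemList l' hm')), ?_⟩
  refine List.ext_getElem (by simp; omega) fun i h1 h2 => ?_
  have h3 : (hl.getEquivOfForallMemList l hm).symm l[i] = ⟨i, by simpa using h1⟩ := by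
    rw [Equiv.symm_apply_eq]; rfl
  simp [h3]

theorem card_mul_card_hamiltonLists_le [Fintype V] {H : SimpleGraph V}
    (hH : ¬ ContainsCopy (cycleGraph 8) H) {n : ℕ} (hn : Fintype.card V = n)
    {𝓛 : Finset (List V)} (h𝓛 : ∀ l ∈ 𝓛, IsHamiltonList H l)
    {m : ℕ} (P : Fin m → Σ u : Fin n, Σ v : Fin n, (⊤ : SimpleGraph (Fin n)).Walk u v)
    (hP : ∀ i, (P i).2.2.IsHamiltonian)
    (hC : ∀ i j, i ≠ j → ContainsCopy (cycleGraph 8) (walkUnion (P i).2.2 (P j).2.2)) :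
    m * #𝓛 ≤ n.factorial := by
  classical
  have key : ∀ x : Fin m × {l // l ∈ 𝓛}, ∃ φ : V ≃ Fin n, x.2.1.map φ = (P x.1).2.2.support :=
    fun x => exists_equiv_map_eq (by simp [hn]) (h𝓛 _ x.2.2).1
      (hP x.1).isPath.support_nodup (h𝓛 _ x.2.2).2.1 fun b => (hP x.1).mem_support b
  choose Φ hΦ using key
  have hinj : Function.Injective Φ := by
    rintro ⟨i, l⟩ ⟨j, l'⟩ h
    have h1 : l.1 = (P i).2.2.support.map (Φ (i, l)).symm := by
      rw [← hΦ (i, l)]; simp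
    have h2 : l'.1 = (P j).2.2.support.map (Φ (i, l)).symm := by
      rw [h, ← hΦ (j, l')]; simp
    by_cases hij : i = j
    · subst hij
      rw [Subtype.ext (h1.trans h2.symm)]
    · obtain ⟨f, hf⟩ := hC i j hij
      refine absurd ⟨f.trans (Φ (i, l)).symm.toEmbedding, fun a b hab => ?_⟩ hH
      have h3 := (h𝓛 _ l.2).2.2
      have h4 := (h𝓛 _ l'.2).2.2
      rw [h1, List.isChain_map] at h3
      rw [h2, List.isChain_map] at h4
      have := hf hab
      rw [walkUnion, Subgraph.spanningCoe_adj, Subgraph.sup_adj] at this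
      rcases this with h | h
      · exact rel_of_toSubgraph_adj (fun a b h => h.symm) _ h3 h
      · exact rel_of_toSubgraph_adj (fun a b h => h.symm) _ h4 h
  have := Fintype.card_le_of_injective Φ hinj
  rw [Fintype.card_prod, Fintype.card_fin, Fintype.card_coe,
    Fintype.card_equiv (Fintype.equivFinOfCardEq hn), hn] at this
  exact this

end CliqueCoclique

section Connectors

variable {X : Type*}

/-- `x` may be followed by `y` in the base sequence. -/
def BaseRel (G : SimpleGraph X) (len : X → ℕ) (nxt : X → X) (x y : X) : Prop :=
  (len x = 0 ∧ G.Adj x y) ∨ (len x ≠ 0 ∧ y = nxt x)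

/-- The directed edges of the graph obtained from `G` by deleting the forward edges at vertices
`x` with `len x ≠ 0` and attaching a path with `len x` new vertices from `x` to `nxt x`. -/
def ConnectorRel (G : SimpleGraph X) (len : X → ℕ) (nxt : X → X)
    (v w : Σ x : X, Fin (len x + 1)) : Prop :=
  (v.1 = w.1 ∧ w.2.val = v.2.val + 1) ∨
    (v.2.val = len v.1 ∧ w.2.val = 0 ∧ BaseRel G len nxt v.1 w.1)

/-- The undirected graph of `ConnectorRel`. -/
def connectorGraph (G : SimpleGraph X) (len : X → ℕ) (nxt : X → X) :
    SimpleGraph (Σ x : X, Fin (len x + 1)) :=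
  SimpleGraph.fromRel (ConnectorRel G len nxt)

/-- Insert the connectors into a base sequence. -/
def expand (len : X → ℕ) (w : List X) : List (Σ x : X, Fin (len x + 1)) :=
  w.flatMap fun x => (List.finRange (len x + 1)).map (Sigma.mk x)

variable {G : SimpleGraph X} {len : X → ℕ} {nxt : X → X}

lemma sigma_fin_ext {v w : Σ x : X, Fin (len x + 1)} (h1 : v.1 = w.1)
    (h2 : v.2.val = w.2.val) : v = w := by
  obtain ⟨x, i⟩ := v
  obtain ⟨y, j⟩ := w
  obtain rfl : x = y := h1
  obtain rfl : i = j := Fin.ext h2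
  rfl

lemma ConnectorRel.source_unique {u u' v : Σ x : X, Fin (len x + 1)} (hv : v.2.val ≠ 0)
    (h : ConnectorRel G len nxt u v) (h' : ConnectorRel G len nxt u' v) : u = u' := by
  rcases h with ⟨h1, h2⟩ | h
  · rcases h' with ⟨h1', h2'⟩ | h'
    · exact sigma_fin_ext (h1.trans h1'.symm) (by omega)
    · exact absurd h'.2.1 hv
  · exact absurd h.2.1 hv

lemma ConnectorRel.target_unique {u u' v : Σ x : X, Fin (len x + 1)} (hv : v.2.val ≠ 0)
    (h : ConnectorRel G len nxt v u) (h' : ConnectorRel G len nxt v u') : u = u' := by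
  have hu := u.2.isLt
  have hu' := u'.2.isLt
  have hlen : len v.1 ≠ 0 := by have := v.2.isLt; omega
  rcases h with ⟨h1, h2⟩ | ⟨h1, h2, h3⟩ <;> rcases h' with ⟨h1', h2'⟩ | ⟨h1', h2', h3'⟩
  · exact sigma_fin_ext (h1.symm.trans h1') (by omega)
  · have := congrArg len h1; omega
  · have := congrArg len h1'; omega
  · rcases h3 with h3 | h3
    · exact absurd h3.1 hlen
    · rcases h3' with h3' | h3'
      · exact absurd h3'.1 hlen
      · exact sigma_fin_ext (h3.2.trans h3'.2.symm) (by omega)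

theorem connectorGraph_not_containsCopy (hG : ¬ ContainsCopy (cycleGraph 8) G)
    (hlen : ∀ x, len x ≠ 0 → 8 ≤ len x) :
    ¬ ContainsCopy (cycleGraph 8) (connectorGraph G len nxt) := by
  intro h
  obtain ⟨f, hinj, hadj⟩ := exists_closed_walk_of_containsCopy h
  have hadj' : ∀ i, ConnectorRel G len nxt (f i) (f (i + 1)) ∨
      ConnectorRel G len nxt (f (i + 1)) (f i) := fun i => (hadj i).2
  by_cases h0 : ∀ i, (f i).2.val = 0
  · refine hG (containsCopy_of_closed_walk (f := fun i => (f i).1) (fun i j hij => ?_) fun i => ?_)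
    · exact hinj (sigma_fin_ext hij ((h0 i).trans (h0 j).symm))
    · have key : ∀ i j, ConnectorRel G len nxt (f i) (f j) → G.Adj (f i).1 (f j).1 := by
        rintro i j (⟨-, h⟩ | ⟨h1, h2, h3⟩)
        · rw [h0, h0] at h; omega
        · rw [h0] at h1
          rcases h3 with h3 | h3
          · exact h3.2
          · exact absurd h1.symm h3.1
      rcases hadj' i with h | h
      · exact key _ _ h
      · exact (key _ _ h).symm
  · push Not at h0
    obtain ⟨i₀, hi₀⟩ := h0
    have nbr : ∀ i, (f i).2.val ≠ 0 → (∃ j, ConnectorRel G len nxt (f j) (f i)) ∧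
        ∃ j, ConnectorRel G len nxt (f i) (f j) := by
      intro i hi
      have h1 := hadj' i
      have h2 := hadj' (i - 1)
      rw [sub_add_cancel] at h2
      have hne : f (i - 1) ≠ f (i + 1) := hinj.ne (by clear h1 h2 hi; revert i; decide)
      rcases h1 with h1 | h1 <;> rcases h2 with h2 | h2
      · exact ⟨⟨_, h2⟩, _, h1⟩
      · exact absurd (h2.target_unique hi h1) hne
      · exact absurd (h2.source_unique hi h1) hne
      · exact ⟨⟨_, h1⟩, _, h2⟩
    set x := (f i₀).1 with hx
    have hlx : 8 ≤ len x := hlen x (by have := (f i₀).2.isLt; have := congrArg len hx; omega)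
    have down : ∀ j, (∃ i, (f i).1 = x ∧ (f i).2.val = j + 1) →
        ∃ i, (f i).1 = x ∧ (f i).2.val = j := by
      rintro j ⟨i, hi1, hi2⟩
      obtain ⟨⟨i', h | h⟩, -⟩ := nbr i (by omega)
      · exact ⟨i', h.1.trans hi1, by omega⟩
      · omega
    have up : ∀ j, j + 1 < len x → (∃ i, (f i).1 = x ∧ (f i).2.val = j + 1) →
        ∃ i, (f i).1 = x ∧ (f i).2.val = j + 2 := by
      rintro j hj ⟨i, hi1, hi2⟩
      obtain ⟨-, i', h | h⟩ := nbr i (by omega)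
      · exact ⟨i', h.1.symm.trans hi1, by omega⟩
      · have := congrArg len hi1; omega
    obtain ⟨d, hd⟩ : ∃ d, (f i₀).2.val = d + 1 := ⟨_, (Nat.succ_pred_eq_of_ne_zero hi₀).symm⟩
    have hone : ∀ d, (∃ i, (f i).1 = x ∧ (f i).2.val = d + 1) →
        ∃ i, (f i).1 = x ∧ (f i).2.val = 1 := by
      intro d
      induction d with
      | zero => exact id
      | succ d ih => exact fun h => ih (down _ h)
    have h1 := hone d ⟨i₀, rfl, hd⟩
    have hall : ∀ j, j + 1 ≤ len x → ∃ i, (f i).1 = x ∧ (f i).2.val = j + 1 := by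
      intro j
      induction j with
      | zero => exact fun _ => h1
      | succ j ih => exact fun hj => up j (by omega) (ih (by omega))
    have hall' : ∀ j : Fin 9, ∃ i, (f i).2.val = j.val := by
      intro j
      refine Fin.cases ?_ (fun j => ?_) j
      · obtain ⟨i, -, hi⟩ := down 0 h1
        exact ⟨i, hi⟩
      · obtain ⟨i, -, hi⟩ := hall j (by omega)
        exact ⟨i, hi⟩
    choose g hg using hall'
    have hginj : Function.Injective g := fun a b hab => by
      apply Fin.ext
      rw [← hg, ← hg, hab]
    simpa using Fintype.card_le_of_injective g hginj

lemma expand_injective : Function.Injective (expand len) := by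
  have key : ∀ w : List X, ((expand len w).filter fun v => v.2.val = 0).map Sigma.fst = w := by
    intro w
    induction w with
    | nil => rfl
    | cons x w ih =>
      have : (expand len (x :: w)) = (List.finRange (len x + 1)).map (Sigma.mk x) ++
        expand len w := rfl
      rw [this, List.filter_append, List.map_append, ih, List.finRange_succ]
      simp [List.filter_map, Function.comp_def]
  exact fun a b h => by rw [← key a, h, key b]

theorem isHamiltonList_expand {w : List X} (hw : w.Nodup) (hm : ∀ x, x ∈ w)
    (hc : w.IsChain (BaseRel G len nxt)) :
    IsHamiltonList (connectorGraph G len nxt) (expand len w) := by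
  have hnd : (expand len w).Nodup := by
    rw [expand, List.nodup_flatMap]
    refine ⟨fun x _ => (List.nodup_finRange _).map sigma_mk_injective, hw.imp fun h => ?_⟩
    intro v h1 h2
    simp only [List.mem_map] at h1 h2
    obtain ⟨_, -, rfl⟩ := h1
    obtain ⟨_, -, h2⟩ := h2
    exact h (congrArg Sigma.fst h2).symm
  refine ⟨hnd, fun v => ?_, ?_⟩
  · rw [expand, List.mem_flatMap]
    exact ⟨v.1, hm _, List.mem_map.2 ⟨v.2, List.mem_finRange _, rfl⟩⟩
  · have h1 : (expand len w).IsChain (ConnectorRel G len nxt) := by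
      rw [expand, List.flatMap, List.isChain_flatten (by simp)]
      refine ⟨fun l hl => ?_, ?_⟩
      · obtain ⟨x, -, rfl⟩ := List.mem_map.1 hl
        rw [List.isChain_map, List.isChain_iff_getElem]
        intro i hi
        exact Or.inl ⟨rfl, by simp⟩
      · rw [List.isChain_map]
        refine hc.imp fun x y hxy => ?_
        intro v hv u hu
        rw [List.finRange_succ_last] at hv
        rw [List.finRange_succ] at hu
        simp at hv hu
        subst hv hu
        exact Or.inr ⟨by simp, by simp, hxy⟩
    rw [List.isChain_iff_getElem] at h1 ⊢
    intro i hi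
    refine ⟨fun h => ?_, Or.inl (h1 i hi)⟩
    have := (hnd.getElem_inj_iff).1 h
    omega

end Connectors

section Rows

open Finset Equiv

variable {Z : Type*} {T : ℕ}

/-- The partial products of a sequence of permutations. -/
def rowPerm (τ : Fin T → Perm Z) : Fin (T + 1) → Perm Z :=
  Fin.induction 1 fun i s => τ i * s

lemma rowPerm_zero (τ : Fin T → Perm Z) : rowPerm τ 0 = 1 := rfl

lemma rowPerm_succ (τ : Fin T → Perm Z) (i : Fin T) :
    rowPerm τ i.succ = τ i * rowPerm τ i.castSucc := by
  simp [rowPerm]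

lemma rowPerm_injective : Function.Injective (rowPerm : (Fin T → Perm Z) → _) := by
  intro τ τ' h
  funext i
  have h1 := rowPerm_succ τ i
  rw [h, rowPerm_succ τ' i] at h1
  exact (mul_right_cancel h1).symm

/-- List the elements of `Fin (T + 1) × Z` row by row, the rows being indexed by `l`. -/
def rowList (σ : Fin (T + 1) → Perm Z) (l : List Z) : List (Fin (T + 1) × Z) :=
  l.flatMap fun z => (List.finRange (T + 1)).map fun j => (j, σ j z)

lemma flatMap_eq_flatMap {α β : Type*} {f g : α → List β} (hlen : ∀ a, (f a).length = (g a).length)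
    {l : List α} (h : l.flatMap f = l.flatMap g) : ∀ a ∈ l, f a = g a := by
  induction l with
  | nil => simp
  | cons a l ih =>
    rw [List.flatMap_cons, List.flatMap_cons] at h
    obtain ⟨h1, h2⟩ := List.append_inj h (hlen a)
    rw [List.forall_mem_cons]
    exact ⟨h1, ih h2⟩

lemma rowList_injective {l : List Z} (hl : ∀ z, z ∈ l) :
    Function.Injective fun σ : Fin (T + 1) → Perm Z => rowList σ l := by
  intro σ σ' h
  funext j
  ext z
  have h1 := flatMap_eq_flatMap (by simp) h z (hl z)
  rw [List.map_inj_left] at h1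
  simpa using h1 j (List.mem_finRange j)

lemma nodup_rowList (σ : Fin (T + 1) → Perm Z) {l : List Z} (hl : l.Nodup) :
    (rowList σ l).Nodup := by
  rw [rowList, List.nodup_flatMap]
  refine ⟨fun z _ => (List.nodup_finRange _).map fun i j h => (Prod.mk.inj h).1,
    hl.imp fun h => ?_⟩
  intro v h1 h2
  simp only [List.mem_map] at h1 h2
  obtain ⟨i, -, rfl⟩ := h1
  obtain ⟨j, -, h2⟩ := h2
  obtain ⟨rfl, h2⟩ := Prod.mk.inj h2
  exact h ((σ j).injective h2).symm

lemma mem_rowList (σ : Fin (T + 1) → Perm Z) {l : List Z} (hl : ∀ z, z ∈ l)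
    (x : Fin (T + 1) × Z) : x ∈ rowList σ l := by
  rw [rowList, List.mem_flatMap]
  exact ⟨(σ x.1).symm x.2, hl _, List.mem_map.2 ⟨x.1, List.mem_finRange _, by simp⟩⟩

lemma isChain_rowList {R : Fin (T + 1) × Z → Fin (T + 1) × Z → Prop} {σ : Fin (T + 1) → Perm Z}
    {l : List Z} (hrow : ∀ (i : Fin T) z, R (i.castSucc, σ i.castSucc z) (i.succ, σ i.succ z))
    (hl : l.IsChain fun z z' => R (Fin.last T, σ (Fin.last T) z) (0, σ 0 z')) :
    (rowList σ l).IsChain R := by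
  rw [rowList, List.flatMap, List.isChain_flatten (by simp)]
  refine ⟨fun l' hl' => ?_, ?_⟩
  · obtain ⟨z, -, rfl⟩ := List.mem_map.1 hl'
    rw [List.isChain_map, List.isChain_iff_getElem]
    intro i hi
    rw [List.length_finRange] at hi
    rw [List.getElem_finRange, List.getElem_finRange]
    exact hrow ⟨i, by omega⟩ z
  · rw [List.isChain_map]
    refine hl.imp fun x y hxy => ?_
    intro v hv u hu
    rw [List.finRange_succ_last] at hv
    rw [List.finRange_succ] at hu
    simp only [List.map_append, List.map_cons, List.map_nil, List.getLast?_concat,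
      List.head?_cons, Option.mem_def, Option.some.injEq] at hv hu
    subst hv hu
    exact hxy

lemma exists_isChain_eq {α : Type*} {l : List α} (hl : l.Nodup) :
    ∃ f : α → α, l.IsChain fun a b => b = f a := by
  classical
  refine ⟨fun a => l.getD (l.idxOf a + 1) a, ?_⟩
  rw [List.isChain_iff_getElem]
  intro i hi
  beta_reduce
  rw [hl.idxOf_getElem, List.getD_eq_getElem _ _ hi]

variable [Fintype Z]

open Classical in
lemma card_unlinked_le (K : Fin T → Finset Z) {k : ℕ} (hK : ∀ i, #(K i) = k) :
    #{x : Fin (T + 1) × Z | ¬ ∃ i : Fin T, x.1 = i.castSucc ∧ x.2 ∈ K i} ≤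
      T * (Fintype.card Z - k) + Fintype.card Z := by
  rw [Finset.card_filter, Fintype.sum_prod_type, Fin.sum_univ_castSucc]
  refine Nat.add_le_add ?_ ?_
  · refine (Finset.sum_le_card_nsmul _ _ (Fintype.card Z - k) fun i _ => ?_).trans (by simp)
    rw [← Finset.card_filter, ← hK i, ← card_compl]
    refine Finset.card_le_card fun z hz => ?_
    simp only [mem_filter, mem_univ, true_and] at hz
    rw [mem_compl]
    exact fun h => hz ⟨i, rfl, h⟩
  · rw [← Finset.card_filter]
    exact Finset.card_le_univ _

theorem mul_pow_le_of_biregular_layers [Nonempty Z] {G : SimpleGraph (Fin (T + 1) × Z)}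
    (hG : ¬ ContainsCopy (cycleGraph 8) G) {r k S n : ℕ}
    (hE : ∀ i : Fin T, IsBiregular (fun z z' => G.Adj (i.castSucc, z) (i.succ, z')) r)
    (hr : 2 * S ^ 2 ≤ r) (hS : 0 < S) (hk : 4 * Fintype.card Z ≤ S * (Fintype.card Z - k))
    (hn : (T + 1) * Fintype.card Z + 8 * (T * (Fintype.card Z - k) + Fintype.card Z) ≤ n)
    {M : ℕ} (P : Fin M → Σ u : Fin n, Σ v : Fin n, (⊤ : SimpleGraph (Fin n)).Walk u v)
    (hP : ∀ i, (P i).2.2.IsHamiltonian)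
    (hC : ∀ i j, i ≠ j → ContainsCopy (cycleGraph 8) (walkUnion (P i).2.2 (P j).2.2)) :
    M * (r ^ k) ^ T ≤
      ((6 * S ^ 2) ^ Fintype.card Z) ^ T * (Fintype.card Z).factorial * n.factorial := by
  classical
  choose K e hKk hcount using fun i => exists_many_perms (hE i) hr hS hk
  set 𝓣 : Finset (Fin T → Perm Z) := Fintype.piFinset fun i => {σ : Perm Z |
    (∀ a ∈ K i, G.Adj (i.castSucc, a) (i.succ, σ a)) ∧ ∀ a ∉ K i, σ a = e i a} with h𝓣
  have h1 : (r ^ k) ^ T ≤ ((6 * S ^ 2) ^ Fintype.card Z) ^ T * #𝓣 := by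
    rw [h𝓣, Fintype.card_piFinset]
    calc (r ^ k) ^ T = ∏ i : Fin T, r ^ k := by simp
      _ ≤ ∏ i : Fin T, _ := Finset.prod_le_prod' fun i _ => hcount i
      _ = _ := by rw [Finset.prod_mul_distrib]; simp
  obtain ⟨ρ, hρ⟩ := exists_card_le_mul_card_fiber 𝓣 fun τ => rowPerm τ (Fin.last T)
  set 𝓡 := ({τ ∈ 𝓣 | rowPerm τ (Fin.last T) = ρ} : Finset _)
  rw [Fintype.card_perm] at hρ
  obtain ⟨next, hnext⟩ := exists_isChain_eq (Finset.nodup_toList (univ : Finset Z))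
  set nxt : Fin (T + 1) × Z → Fin (T + 1) × Z := fun x =>
    Fin.lastCases (motive := fun _ => Fin (T + 1) × Z) (0, next (ρ.symm x.2))
      (fun i => (i.succ, e i x.2)) x.1 with hnxt
  set linked : Fin (T + 1) × Z → Prop := fun x => ∃ i : Fin T, x.1 = i.castSucc ∧ x.2 ∈ K i
  set x₀ : Fin (T + 1) × Z := (Fin.last T, Classical.arbitrary Z)
  have hx₀ : ¬ linked x₀ := fun ⟨i, hi, _⟩ => (Fin.castSucc_lt_last i).ne hi.symm
  have hunl : #{x | ¬ linked x} ≤ _ := card_unlinked_le K hKk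
  set d := n - (Fintype.card (Fin (T + 1) × Z) + 8 * #{x | ¬ linked x})
  set len : Fin (T + 1) × Z → ℕ := fun x =>
    (if linked x then 0 else 8) + if x = x₀ then d else 0 with hlen
  have hlen0 : ∀ x, linked x → len x = 0 := fun x hx => by
    have : x ≠ x₀ := fun h => hx₀ (h ▸ hx)
    simp [hlen, hx, this]
  have hlen8 : ∀ x, ¬ linked x → 8 ≤ len x := fun x hx => by simp [hlen, hx]
  have hcard : Fintype.card (Σ x, Fin (len x + 1)) = n := by
    rw [Fintype.card_sigma]
    simp only [Fintype.card_fin, hlen, Finset.sum_add_distrib]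
    rw [Finset.sum_ite_eq' univ x₀, if_pos (mem_univ _), Finset.sum_ite]
    simp only [sum_const_zero, zero_add, sum_const, smul_eq_mul, mul_one, Finset.card_univ]
    have : Fintype.card (Fin (T + 1) × Z) = (T + 1) * Fintype.card Z := by simp
    omega
  have hchain : ∀ τ ∈ 𝓡, (rowList (rowPerm τ) univ.toList).IsChain (BaseRel G len nxt) := by
    intro τ hτ
    obtain ⟨hτ1, hτ2⟩ := mem_filter.1 hτ
    rw [h𝓣, Fintype.mem_piFinset] at hτ1
    refine isChain_rowList (fun i z => ?_) (hnext.imp fun z z' h => ?_)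
    · obtain ⟨h2, h3⟩ := (mem_filter.1 (hτ1 i)).2
      rw [rowPerm_succ, Perm.mul_apply]
      by_cases hz : rowPerm τ i.castSucc z ∈ K i
      · exact Or.inl ⟨hlen0 _ ⟨i, rfl, hz⟩, h2 _ hz⟩
      · refine Or.inr ⟨?_, ?_⟩
        · have := hlen8 (i.castSucc, rowPerm τ i.castSucc z) (by
            rintro ⟨j, hj, hj'⟩
            obtain rfl := Fin.castSucc_injective _ hj
            exact hz hj')
          omega
        · simp [hnxt, h3 _ hz]
    · refine Or.inr ⟨?_, ?_⟩
      · have := hlen8 (Fin.last T, rowPerm τ (Fin.last T) z)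
          fun ⟨i, hi, _⟩ => (Fin.castSucc_lt_last i).ne hi.symm
        omega
      · simp [hnxt, hτ2, rowPerm_zero, h]
  have hnd : (univ : Finset Z).toList.Nodup := Finset.nodup_toList _
  have hmem : ∀ z : Z, z ∈ (univ : Finset Z).toList := fun z => by simp
  have h2 := card_mul_card_hamiltonLists_le (n := n)
    (connectorGraph_not_containsCopy (len := len) (nxt := nxt) hG fun x hx =>
      hlen8 x fun h => hx (hlen0 x h)) hcard
    (𝓛 := 𝓡.image fun τ => expand len (rowList (rowPerm τ) univ.toList)) (fun l hl => by
      obtain ⟨τ, hτ, rfl⟩ := mem_image.1 hl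
      exact isHamiltonList_expand (nodup_rowList _ hnd) (mem_rowList _ hmem) (hchain τ hτ))
    P hP hC
  rw [Finset.card_image_of_injective _ (f := fun τ => expand len (rowList (rowPerm τ) univ.toList))
    (expand_injective.comp ((rowList_injective hmem).comp rowPerm_injective))] at h2
  calc M * (r ^ k) ^ T
      ≤ M * (((6 * S ^ 2) ^ Fintype.card Z) ^ T * ((Fintype.card Z).factorial * #𝓡)) := by
        gcongr
        exact h1.trans (Nat.mul_le_mul_left _ hρ)
    _ = ((6 * S ^ 2) ^ Fintype.card Z) ^ T * (Fintype.card Z).factorial * (M * #𝓡) := by ring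
    _ ≤ _ := Nat.mul_le_mul_left _ h2

end Rows

section Asymptotics

open Real

/-- The count obtained from `T + 1` layers with `T * u` vertices each. -/
lemma mul_pow_le_of_prime {T r q c u n : ℕ} (hq : q.Prime) (hT : 0 < T)
    (hr : 2 * (4 * T) ^ 2 ≤ r) (hrq : (T + 1) * r ≤ q) (hc : 0 < c) (hu : u = r * q ^ 4 * c)
    (hn : (T + 17) * (T * u) ≤ n) {M : ℕ}
    (P : Fin M → Σ u : Fin n, Σ v : Fin n, (⊤ : SimpleGraph (Fin n)).Walk u v)
    (hP : ∀ i, (P i).2.2.IsHamiltonian)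
    (hC : ∀ i j, i ≠ j → ContainsCopy (cycleGraph 8) (walkUnion (P i).2.2 (P j).2.2)) :
    M * (r ^ ((T - 1) * u)) ^ T ≤
      ((96 * T ^ 2) ^ (T * u)) ^ T * (T * u).factorial * n.factorial := by
  have : Fact q.Prime := ⟨hq⟩
  have hr0 : 0 < r := lt_of_lt_of_le (by positivity) hr
  have : NeZero r := ⟨hr0.ne'⟩
  have : NeZero (T * c) := ⟨by positivity⟩
  obtain ⟨a⟩ : Nonempty (Fin (T + 1) × Fin r ↪ ZMod q) :=
    Function.Embedding.nonempty_of_card_le (by simpa using hrq)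
  have hcard : Fintype.card
      (Fin r × (ZMod q × ZMod q × ZMod q × ZMod q) × Fin (T * c)) = T * u := by
    simp only [Fintype.card_prod, Fintype.card_fin, ZMod.card]
    rw [hu]; ring
  have hsub : T * u - (T - 1) * u = u := by
    rw [← Nat.sub_mul, show T - (T - 1) = 1 by omega, one_mul]
  have := mul_pow_le_of_biregular_layers (n := n) (r := r) (k := (T - 1) * u) (S := 4 * T)
    (layeredGraph_not_containsCopy (c := a) (k := T * c)) isBiregular_layeredGraph hr (by positivity)
    (by rw [hcard, hsub]; exact le_of_eq (by ring))
    (by rw [hcard, hsub]; exact le_trans (le_of_eq (by ring)) hn) P hP hC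
  rw [hcard] at this
  convert this using 5
  ring

lemma log_le_of_mul_pow_le {T r u n M : ℕ} (hM : 0 < M) (hr : 0 < r) (hT : 0 < T) (hu : 0 < u)
    (hn : T * u ≤ n) (h : M * (r ^ ((T - 1) * u)) ^ T ≤
      ((96 * T ^ 2) ^ (T * u)) ^ T * (T * u).factorial * n.factorial) :
    log M + (T - 1) * (T * u) * log r ≤
      T * (T * u) * log (96 * T ^ 2) + T * u * log n + n * log n := by
  have hn0 : 0 < n := lt_of_lt_of_le (by positivity) hn
  have h1 : M * (r ^ ((T - 1) * u)) ^ T ≤ ((96 * T ^ 2) ^ (T * u)) ^ T * n ^ (T * u) * n ^ n := by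
    refine h.trans ?_
    gcongr
    · exact (Nat.factorial_le_pow _).trans (Nat.pow_le_pow_left hn _)
    · exact Nat.factorial_le_pow _
  have h2 : (M : ℝ) * (r ^ ((T - 1) * u)) ^ T ≤
      ((96 * T ^ 2) ^ (T * u)) ^ T * n ^ (T * u) * n ^ n := by exact_mod_cast h1
  have h3 := Real.log_le_log (by positivity) h2
  rw [log_mul (by positivity) (by positivity), log_mul (by positivity) (by positivity),
    log_mul (by positivity) (by positivity)] at h3
  simp only [log_pow, Nat.cast_mul, Nat.cast_sub hT, Nat.cast_one] at h3
  linarith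

lemma exists_mul_pow_five_le (B n : ℕ) (hB : 0 < B) : ∃ r, B * r ^ 5 ≤ n ∧ n < B * (r + 1) ^ 5 := by
  have hex : ∃ r, n < B * (r + 1) ^ 5 := by
    refine ⟨n, ?_⟩
    calc n < n + 1 := Nat.lt_succ_self n
      _ ≤ (n + 1) ^ 5 := Nat.le_self_pow (by norm_num) _
      _ ≤ B * (n + 1) ^ 5 := Nat.le_mul_of_pos_left _ hB
  classical
  refine ⟨Nat.find hex, ?_, Nat.find_spec hex⟩
  rcases h : Nat.find hex with _ | r
  · simp
  · exact not_lt.1 (Nat.find_min hex (by omega : r < Nat.find hex))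

/-- For large `n` the construction has parameters that nearly exhaust `n`. -/
lemma exists_parameters_s1 (T : ℕ) (hT : 2 ≤ T) : ∃ B n₀ : ℕ, 0 < B ∧ ∀ n ≥ n₀, ∃ r q c : ℕ,
    q.Prime ∧ 2 * (4 * T) ^ 2 ≤ r ∧ (T + 1) * r ≤ q ∧ 0 < c ∧
    (T + 17) * (T * (r * q ^ 4 * c)) ≤ n ∧
    (T - 1) * n ≤ T * ((T + 17) * (T * (r * q ^ 4 * c))) ∧ n ≤ B * r ^ 5 := by
  set B := (T + 17) * T ^ 2 * (2 * (T + 1)) ^ 4 with hB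
  have hB0 : 0 < B := by positivity
  refine ⟨32 * B, B * (2 * (4 * T) ^ 2 + 1) ^ 5, by positivity, fun n hn => ?_⟩
  obtain ⟨r, hr1, hr2⟩ := exists_mul_pow_five_le B n hB0
  have hr : 2 * (4 * T) ^ 2 ≤ r := by
    have := lt_of_pow_lt_pow_left₀ 5 (by positivity) (Nat.lt_of_mul_lt_mul_left (hn.trans_lt hr2))
    omega
  have hr0 : 0 < r := lt_of_lt_of_le (by positivity) hr
  obtain ⟨q, hq, hq1, hq2⟩ := Nat.exists_prime_lt_and_le_two_mul ((T + 1) * r) (by positivity)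
  set D := (T + 17) * (T * (r * q ^ 4)) with hD
  have hD0 : 0 < D := by have := hq.pos; positivity
  have hDn : T * D ≤ n := by
    refine le_trans ?_ hr1
    calc T * D ≤ T * ((T + 17) * (T * (r * (2 * ((T + 1) * r)) ^ 4))) := by
          rw [hD]; gcongr
      _ = B * r ^ 5 := by rw [hB]; ring
  have e : (T + 17) * (T * (r * q ^ 4 * (n / D))) = D * (n / D) := by rw [hD]; ring
  refine ⟨r, q, n / D, hq, hr, hq1.le, Nat.div_pos (le_trans ?_ hDn) hD0, ?_, ?_, ?_⟩
  · exact Nat.le_mul_of_pos_left _ (by omega)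
  · rw [e]; exact Nat.mul_div_le n D
  · rw [e, Nat.sub_mul, one_mul]
    have h1 := Nat.div_add_mod n D
    have h2 := Nat.mod_lt n hD0
    have h3 : T * n = T * (D * (n / D)) + T * (n % D) := by rw [← Nat.mul_add, h1]
    have h4 : T * (n % D) ≤ T * D := Nat.mul_le_mul_left _ h2.le
    omega
  · calc n ≤ B * (r + 1) ^ 5 := hr2.le
      _ ≤ B * (r + r) ^ 5 := by gcongr; omega
      _ = 32 * B * r ^ 5 := by ring

/-- The entropy balance of the construction. -/
lemma log_count_le {ε T a n L R C x : ℝ} (hT : 7 ≤ T) (hTε : 10 ≤ ε * T)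
    (ha : 0 ≤ a) (hL : 0 ≤ L) (hC : 0 ≤ C) (han : (T + 17) * a ≤ n)
    (hna : (T - 1) * n ≤ T * ((T + 17) * a))
    (hR : L ≤ C + 5 * R) {D : ℝ} (hD : 0 ≤ D) (hCD : C + D ≤ ε / 2 * L)
    (h : x + (T - 1) * a * R ≤ T * a * D + a * L + n * L) : x ≤ (4 / 5 + ε) * n * L := by
  have hn : 0 ≤ n := le_trans (by positivity) han
  have h1 : T * a * D ≤ n * D := by
    have : T * a ≤ n := by nlinarith
    gcongr
  have h2 : (T - 1) * a * (L - C) / 5 ≤ (T - 1) * a * R := by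
    have : 0 ≤ (T - 1) * a := mul_nonneg (by linarith) ha
    nlinarith
  have h3 : (T - 1) * a * C ≤ n * C := by
    have : (T - 1) * a ≤ n := by nlinarith
    gcongr
  have h4 : n * (1 / 5 - ε / 2) ≤ (T - 6) * a / 5 := by
    have e1 : T * (T + 17) * (n * (1 / 5 - ε / 2)) ≤ T * (T + 17) * ((T - 6) * a / 5) := by
      have e2 : (T - 6) * ((T - 1) * n) ≤ (T - 6) * (T * ((T + 17) * a)) := by
        have : 0 ≤ T - 6 := by linarith
        gcongr
      have e3 : T * (T + 17) * (1 / 5 - ε / 2) ≤ (T - 6) * (T - 1) / 5 := by nlinarith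
      have e4 := mul_le_mul_of_nonneg_left e3 hn
      nlinarith
    exact le_of_mul_le_mul_left e1 (by nlinarith)
  have h5 : n * (1 / 5 - ε / 2) * L ≤ (T - 6) * a / 5 * L := by gcongr
  have h6 : n * (C + D) ≤ n * (ε / 2 * L) := by gcongr
  nlinarith [mul_nonneg hn hC]

end Asymptotics

/-- H_n(C₈) ≤ n ^ ((4/5) n + o(n)). -/
theorem Hn_C8_upper :
    ∀ ε : ℝ, 0 < ε → ∃ n₀ : ℕ, ∀ n : ℕ, n₀ ≤ n →
      ∀ (m : ℕ) (P : Fin m → Σ u : Fin n, Σ v : Fin n, (⊤ : SimpleGraph (Fin n)).Walk u v),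
        Function.Injective P →
        (∀ i, (P i).2.2.IsHamiltonian) →
        (∀ i j, i ≠ j → ContainsCopy (cycleGraph 8) (walkUnion (P i).2.2 (P j).2.2)) →
        (m : ℝ) ≤ (n : ℝ) ^ ((4 / 5 + ε) * n) := by
  intro ε hε
  obtain ⟨T, hT⟩ := exists_nat_ge (max 7 (10 / ε))
  have hT7 : (7 : ℝ) ≤ T := (le_max_left _ _).trans hT
  have hT7' : 7 ≤ T := by exact_mod_cast hT7
  have hTε : 10 ≤ ε * T := by
    have := (le_max_right _ _).trans hT
    rwa [div_le_iff₀' hε] at this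
  obtain ⟨B, n₀, hB, hpar⟩ := exists_parameters_s1 T (by omega)
  have hlarge : ∀ᶠ n : ℕ in Filter.atTop,
      Real.log B + Real.log (96 * T ^ 2) ≤ ε / 2 * Real.log n :=
    ((Real.tendsto_log_atTop.comp tendsto_natCast_atTop_atTop).const_mul_atTop
      (half_pos hε)).eventually_ge_atTop _
  obtain ⟨n₁, hn₁⟩ := Filter.eventually_atTop.1 hlarge
  refine ⟨max 1 (max n₀ n₁), fun n hn m P _ hP hC => ?_⟩
  obtain ⟨hn1, hn2, hn3⟩ : 1 ≤ n ∧ n₀ ≤ n ∧ n₁ ≤ n := by simpa using hn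
  rcases Nat.eq_zero_or_pos m with rfl | hm
  · rw [Nat.cast_zero]
    positivity
  obtain ⟨r, q, c, hq, hr, hrq, hc, hle, hge, hnr⟩ := hpar n hn2
  have hr0 : 0 < r := lt_of_lt_of_le (by positivity) hr
  have hu0 : 0 < r * q ^ 4 * c := by have := hq.pos; positivity
  have hn0 : (0 : ℝ) < n := by exact_mod_cast hn1
  have hlog := log_le_of_mul_pow_le hm hr0 (by omega) hu0
    ((Nat.le_mul_of_pos_left _ (by omega)).trans hle)
    (mul_pow_le_of_prime hq (by omega) hr hrq hc rfl hle P hP hC)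
  have hR : Real.log n ≤ Real.log B + 5 * Real.log r := by
    have hnr' : (n : ℝ) ≤ B * r ^ 5 := by exact_mod_cast hnr
    have := Real.log_le_log hn0 hnr'
    rwa [Real.log_mul (by positivity) (by positivity), Real.log_pow] at this
  have hge' : ((T : ℝ) - 1) * n ≤ T * ((T + 17) * (T * (r * q ^ 4 * c : ℕ))) := by
    have h : ((T - 1 : ℕ) : ℝ) * n ≤ T * ((T + 17) * (T * (r * q ^ 4 * c : ℕ))) := by
      exact_mod_cast hge
    rwa [Nat.cast_sub (by omega), Nat.cast_one] at h
  have hmain := log_count_le hT7 hTε (by positivity) (Real.log_natCast_nonneg n)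
    (Real.log_natCast_nonneg B) (by exact_mod_cast hle) hge' hR
    (Real.log_nonneg (by nlinarith)) (hn₁ n hn3) hlog
  rw [← Real.log_le_log_iff (by positivity) (by positivity), Real.log_rpow hn0]
  exact hmain
end
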